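/- arXiv:1206.3715 — 2 statements merged into one kernel-verified Lean document; each statement's English description precedes it below -/
import Mathlib

section
/- The only positive integer solutions (x, y, h, n) of the equation x^2 + 2^h = y^n with n > 1, y odd and h > 2 are (x, y, h, n) = (7, 3, 5, 4) and, for each h > 2, (x, y, n) = (2^(h-2) − 1, 2^(h-2) + 1, 2). -/
section

open Finset

/-- If at most one index carries each weight below the number of indices, the weights sum to at
least `0 + 1 + ⋯ + (N - 1)`. -/
theorem sum_range_le_sum_of_injective_below {ι : Type*} [Fintype ι] [DecidableEq ι] (w : ι → ℕ)
    (hw : ∀ i j, w i = w j → w i < Fintype.card ι → i = j) :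
    Fintype.card ι * (Fintype.card ι - 1) / 2 ≤ ∑ i, w i := by
  classical
  set N := Fintype.card ι with hN
  have hlow : ∀ v < N, (univ.filter fun i => w i ≤ v).card ≤ v + 1 := by
    intro v hv
    have : (univ.filter fun i => w i ≤ v).card ≤ (range (v + 1)).card := by
      apply card_le_card_of_injOn w
      · intro i hi
        simp only [coe_filter, mem_univ, true_and, Set.mem_ofPred_eq] at hi
        simp only [coe_range, Set.mem_Iio]
        omega
      · intro i hi j hj hij
        simp only [coe_filter, mem_univ, true_and, Set.mem_ofPred_eq] at hi
        exact hw i j hij (by omega)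
    simpa using this
  have hhigh : ∀ v ∈ range N, N - 1 - v ≤ (univ.filter fun i => v < w i).card := by
    intro v hv
    have h1 := hlow v (mem_range.mp hv)
    have h2 := card_filter_add_card_filter_not (s := (univ : Finset ι)) (fun i => w i ≤ v)
    simp only [not_le, card_univ] at h2
    omega
  calc N * (N - 1) / 2 = ∑ v ∈ range N, v := (sum_range_id N).symm
    _ = ∑ v ∈ range N, (N - 1 - v) := (sum_range_reflect (fun v => v) N).symm
    _ ≤ ∑ v ∈ range N, (univ.filter fun i => v < w i).card := sum_le_sum hhigh
    _ = ∑ v ∈ range N, ∑ i, (if v < w i then 1 else 0) := by simp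
    _ = ∑ i, ∑ v ∈ range N, (if v < w i then 1 else 0) := sum_comm
    _ ≤ ∑ i, w i := by
      refine sum_le_sum fun i _ => ?_
      rw [← card_filter]
      calc _ ≤ (range (w i)).card := card_le_card fun v => by simp
        _ = w i := by simp

theorem norm_det_le_factorial_mul_prod {ι : Type*} [Fintype ι] [DecidableEq ι]
    (M : Matrix ι ι ℂ) (c : ι → ℝ) (hM : ∀ i j, ‖M j i‖ ≤ c j) :
    ‖M.det‖ ≤ (Fintype.card ι).factorial * ∏ j, c j := by
  rw [← Matrix.det_transpose, Matrix.det_apply]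
  calc _ ≤ ∑ σ : Equiv.Perm ι, ‖Equiv.Perm.sign σ • ∏ i, M.transpose (σ i) i‖ := norm_sum_le _ _
    _ ≤ ∑ σ : Equiv.Perm ι, ∏ j, c j := by
      refine sum_le_sum fun σ _ => ?_
      have : ‖Equiv.Perm.sign σ • ∏ i, M.transpose (σ i) i‖ = ∏ i, ‖M i (σ i)‖ := by
        rcases Int.units_eq_one_or (Equiv.Perm.sign σ) with h | h <;> simp [h, norm_prod]
      rw [this]
      exact prod_le_prod (fun _ _ => norm_nonneg _) fun i _ => hM _ _
    _ = _ := by simp [Fintype.card_perm]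

/-- Upper bound for an interpolation determinant: the columns are values at points of modulus at
most `X` of polynomials with controlled coefficients, up to a small error. -/
theorem norm_interpolation_det_le {ι : Type*} [Fintype ι] [DecidableEq ι] (T : ℕ)
    (x : ι → ℂ) (a : ι → Fin T → ℂ) (e : ι → ι → ℂ) (F : ι → ℝ) (X ρ : ℝ) (hX : 0 ≤ X)
    (hρ : 1 ≤ ρ) (hx : ∀ i, ‖x i‖ ≤ X)
    (ha : ∀ j, ∑ n, ‖a j n‖ * (ρ * X) ^ (n : ℕ) ≤ F j)
    (he : ∀ j i, ‖e j i‖ * ρ ^ Fintype.card ι ≤ F j) :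
    ‖(Matrix.of fun j i => ∑ n, a j n * x i ^ (n : ℕ) + e j i).det‖ *
        ρ ^ (Fintype.card ι * (Fintype.card ι - 1) / 2) ≤
      (Fintype.card ι).factorial * ∏ j, (2 * F j) := by
  classical
  set N := Fintype.card ι with hN
  have hρ0 : 0 < ρ := by linarith
  have hF : ∀ j, 0 ≤ F j := fun j =>
    le_trans (sum_nonneg fun n _ => by positivity) (ha j)
  let v : ι → Option (Fin T) → ι → ℂ := fun j o i => o.elim (e j i) fun n => a j n * x i ^ (n : ℕ)
  let C : ι → Option (Fin T) → ℝ := fun j o =>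
    o.elim (F j) fun n => ‖a j n‖ * (ρ * X) ^ (n : ℕ)
  let wt : Option (Fin T) → ℕ := fun o => o.elim N fun n => n
  have hC0 : ∀ j o, 0 ≤ C j o := by
    rintro j (_ | n)
    · exact hF j
    · simp only [C, Option.elim]; positivity
  have hv : ∀ j o i, ‖v j o i‖ ≤ C j o * (ρ ^ wt o)⁻¹ := by
    rintro j (_ | n) i
    · simp only [v, C, wt, Option.elim]
      rw [← div_eq_mul_inv, le_div_iff₀ (by positivity)]
      exact he j i
    · simp only [v, C, wt, Option.elim]
      rw [norm_mul, norm_pow, mul_pow, mul_assoc]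
      have : ρ ^ (n : ℕ) * X ^ (n : ℕ) * (ρ ^ (n : ℕ))⁻¹ = X ^ (n : ℕ) := by field_simp
      rw [this]
      gcongr
      exact hx i
  have hexp : (Matrix.of fun j i => ∑ n, a j n * x i ^ (n : ℕ) + e j i).det =
      ∑ g : ι → Option (Fin T), (Matrix.of fun j => v j (g j)).det := by
    have h1 : (Matrix.of fun j i => ∑ n, a j n * x i ^ (n : ℕ) + e j i) =
        Matrix.of fun j => ∑ o, v j o := by
      ext j i
      simp [v, Fintype.sum_option, add_comm]
    rw [h1]
    exact (Matrix.detRowAlternating (n := ι) (R := ℂ)).toMultilinearMap.map_sum v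
  have hterm : ∀ g : ι → Option (Fin T), ‖(Matrix.of fun j => v j (g j)).det‖ *
      ρ ^ (N * (N - 1) / 2) ≤ N.factorial * ∏ j, C j (g j) := by
    intro g
    have hprod0 : 0 ≤ ∏ j, C j (g j) := prod_nonneg fun j _ => hC0 j _
    by_cases hg : ∀ i j, wt (g i) = wt (g j) → wt (g i) < N → i = j
    · have h1 := sum_range_le_sum_of_injective_below (fun j => wt (g j)) hg
      have h2 := norm_det_le_factorial_mul_prod (Matrix.of fun j => v j (g j))
        (fun j => C j (g j) * (ρ ^ wt (g j))⁻¹) (fun i j => hv j (g j) i)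
      rw [prod_mul_distrib, prod_inv_distrib, prod_pow_eq_pow_sum] at h2
      have h3 : ρ ^ (N * (N - 1) / 2) ≤ ρ ^ ∑ j, wt (g j) := pow_le_pow_right₀ hρ h1
      calc _ ≤ (N.factorial * ((∏ j, C j (g j)) * (ρ ^ ∑ j, wt (g j))⁻¹)) *
            ρ ^ ∑ j, wt (g j) := by gcongr
        _ = _ := by field_simp
    · push Not at hg
      obtain ⟨i, j, hij, hlt, hne⟩ := hg
      have : (Matrix.of fun j => v j (g j)).det = 0 := by
        rcases hi : g i with _ | n
        · simp [wt, hi] at hlt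
        rcases hj : g j with _ | n'
        · rw [hij] at hlt; simp [wt, hj] at hlt
        have hnn : n = n' := by
          simp only [wt, hi, hj, Option.elim] at hij
          exact Fin.ext hij
        subst hnn
        let u : ι → ℂ := fun i => x i ^ (n : ℕ)
        have hvi : v i (g i) = a i n • u := by ext; simp [v, hi, u]
        have hvj : v j (g j) = a j n • u := by ext; simp [v, hj, u]
        by_cases h0 : a j n = 0
        · apply Matrix.det_eq_zero_of_row_eq_zero j
          intro k
          simp [hvj, h0]
        · have := Matrix.det_updateRow_add_smul_self (Matrix.of fun j => v j (g j)) hne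
            (-(a i n / a j n))
          rw [← this]
          apply Matrix.det_eq_zero_of_row_eq_zero i
          intro k
          simp only [Matrix.updateRow_self, Pi.add_apply, Pi.smul_apply, Matrix.of_apply, hvi, hvj,
            smul_eq_mul]
          field_simp
          ring
      rw [this]
      simp only [norm_zero, zero_mul]
      positivity
  rw [hexp]
  calc _ ≤ (∑ g : ι → Option (Fin T), ‖(Matrix.of fun j => v j (g j)).det‖) *
        ρ ^ (N * (N - 1) / 2) := by gcongr; exact norm_sum_le _ _
    _ ≤ ∑ g : ι → Option (Fin T), N.factorial * ∏ j, C j (g j) := by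
      rw [sum_mul]; exact sum_le_sum fun g _ => hterm g
    _ = N.factorial * ∏ j, ∑ o, C j o := by
      rw [← mul_sum, prod_univ_sum, Fintype.piFinset_univ]
    _ ≤ _ := by
      gcongr with j
      · exact fun j _ => sum_nonneg fun o _ => hC0 j o
      · rw [Fintype.sum_option]
        simp only [C, Option.elim]
        have := ha j
        linarith

theorem exists_det_ne_zero_of_linearIndependent {κ P : Type*} [Fintype κ] [DecidableEq κ]
    (M : κ → P → ℂ) (h : LinearIndependent ℂ M) :
    ∃ f : κ → P, (Matrix.of fun j i => M j (f i)).det ≠ 0 := by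
  classical
  let s : Set (κ → ℂ) := Set.range fun p j => M j p
  have hspan : Submodule.span ℂ s = ⊤ := by
    by_contra hne
    obtain ⟨φ, hφ, hs⟩ := Submodule.exists_le_ker_of_lt_top _ (lt_top_iff_ne_top.mpr hne)
    apply hφ
    have hsum : ∑ j, φ (Pi.single j 1) • M j = 0 := by
      ext p
      have hp : φ (fun j => M j p) = 0 := hs (Submodule.subset_span ⟨p, rfl⟩)
      have : (fun j => M j p) = ∑ j, M j p • (Pi.single j 1 : κ → ℂ) := by
        ext j; simp [Finset.sum_apply, Pi.single_apply]
      rw [this, map_sum] at hp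
      simpa [mul_comm] using hp
    have hz := Fintype.linearIndependent_iff.mp h _ hsum
    ext j
    simpa using hz j
  obtain ⟨b, hbs, hbspan, hbi⟩ := exists_linearIndependent ℂ s
  let B : Module.Basis b ℂ (κ → ℂ) := Module.Basis.mk hbi (by simp [hbspan, hspan])
  have : Fintype b := FiniteDimensional.fintypeBasisIndex B
  have hcard : Fintype.card κ = Fintype.card b := by
    rw [← Module.finrank_eq_card_basis B, Module.finrank_fintype_fun_eq_card]
  let e : κ ≃ b := Fintype.equivOfCardEq hcard
  choose f hf using fun i : κ => hbs (e i).2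
  refine ⟨f, ?_⟩
  have hli : LinearIndependent ℂ fun i : κ => ((e i : b) : κ → ℂ) := hbi.comp e e.injective
  rw [← Matrix.det_transpose]
  have : (Matrix.of fun j i => M j (f i)).transpose = Matrix.of fun i : κ => ((e i : b) : κ → ℂ) := by
    ext i j
    simp [← hf i]
  rw [this]
  have hu := (Matrix.linearIndependent_rows_iff_isUnit (A := Matrix.of fun i : κ => ((e i : b) : κ → ℂ))).mp hli
  exact ((Matrix.isUnit_iff_isUnit_det _).mp hu).ne_zero

theorem Polynomial.coeff_prod_of_natDegree_le_sum {ι R : Type*} [CommRing R] (s : Finset ι)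
    (f : ι → Polynomial R) (d : ι → ℕ) (h : ∀ i ∈ s, (f i).natDegree ≤ d i) :
    (∏ i ∈ s, f i).coeff (∑ i ∈ s, d i) = ∏ i ∈ s, (f i).coeff (d i) := by
  classical
  induction s using Finset.induction_on with
  | empty => simp
  | insert i s hi ih =>
    rw [prod_insert hi, sum_insert hi, prod_insert hi, ← ih fun j hj => h j (mem_insert_of_mem hj)]
    refine coeff_mul_add_eq_of_natDegree_le (h i (mem_insert_self _ _)) ?_
    exact (natDegree_prod_le _ _).trans
      (sum_le_sum fun j hj => h j (mem_insert_of_mem hj))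

theorem Polynomial.natDegree_det_le_sum {κ R : Type*} [Fintype κ] [DecidableEq κ] [CommRing R]
    (M : Matrix κ κ (Polynomial R)) (d : κ → ℕ) (h : ∀ i j, (M i j).natDegree ≤ d j) :
    M.det.natDegree ≤ ∑ j, d j := by
  rw [Matrix.det_apply]
  refine natDegree_sum_le_of_forall_le _ _ fun σ _ => ?_
  have h1 : (∏ i, M (σ i) i).natDegree ≤ ∑ j, d j :=
    (natDegree_prod_le _ _).trans (sum_le_sum fun j _ => h _ _)
  rcases Int.units_eq_one_or (Equiv.Perm.sign σ) with hs | hs <;> simpa [hs] using h1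

theorem Polynomial.coeff_det_sum {κ R : Type*} [Fintype κ] [DecidableEq κ] [CommRing R]
    (M : Matrix κ κ (Polynomial R)) (d : κ → ℕ) (h : ∀ i j, (M i j).natDegree ≤ d j) :
    M.det.coeff (∑ j, d j) = (Matrix.of fun i j => (M i j).coeff (d j)).det := by
  rw [Matrix.det_apply, Matrix.det_apply, finsetSum_coeff]
  refine sum_congr rfl fun σ _ => ?_
  have h1 := coeff_prod_of_natDegree_le_sum univ (fun i => M (σ i) i) d fun j _ => h _ _
  rcases Int.units_eq_one_or (Equiv.Perm.sign σ) with hs | hs <;> simp [hs, h1]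

/-- Zero estimate for exponential polynomials: `∑ l, Q l (x g) * w g ^ l` cannot vanish on a large
sumset unless all `Q l` vanish. -/
theorem eq_zero_of_forall_sum_eval_mul_pow_eq_zero {G : Type*} [AddCommGroup G] (x : G →+ ℂ)
    (w : G → ℂ) (hw : ∀ g h, w (g + h) = w g * w h) (hw0 : ∀ g, w g ≠ 0) (D L : ℕ)
    (Q : Fin L → Polynomial ℂ) (hdeg : ∀ l, (Q l).natDegree ≤ D) (E₁ E₂ : Finset G)
    (h₁ : L ≤ (E₁.image w).card) (h₂ : L * D < (E₂.image x).card)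
    (hv : ∀ g ∈ E₁, ∀ h ∈ E₂, ∑ l, (Q l).eval (x (g + h)) * w (g + h) ^ (l : ℕ) = 0) :
    ∀ l, Q l = 0 := by
  classical
  by_contra hQ
  push Not at hQ
  obtain ⟨l₀, hl₀⟩ := hQ
  let κ := {l : Fin L // Q l ≠ 0}
  have hli : LinearIndependent ℂ fun (l : Fin L) (g : E₁) => w g ^ (l : ℕ) := by
    rw [Fintype.linearIndependent_iff]
    intro c hc
    let P : Polynomial ℂ := ∑ l : Fin L, Polynomial.monomial (l : ℕ) (c l)
    have hPd : P.natDegree < L := by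
      have : 0 < L := l₀.pos
      refine lt_of_le_of_lt (Polynomial.natDegree_sum_le_of_forall_le _ _ (n := L - 1) ?_) (by omega)
      intro l _
      exact (Polynomial.natDegree_monomial_le _).trans (by omega)
    have hP : P = 0 := by
      refine Polynomial.eq_zero_of_natDegree_lt_card_of_eval_eq_zero' P (E₁.image w) ?_
        (lt_of_lt_of_le hPd h₁)
      intro z hz
      obtain ⟨g, hg, rfl⟩ := mem_image.mp hz
      have := congrFun hc ⟨g, hg⟩
      simpa [P, Polynomial.eval_finsetSum, Finset.sum_apply] using this
    intro l
    have := congrArg (fun p => Polynomial.coeff p (l : ℕ)) hP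
    simpa [P, Polynomial.finsetSum_coeff, Polynomial.coeff_monomial, Fin.val_inj] using this
  have hli' : LinearIndependent ℂ fun (l : κ) (g : E₁) => w g ^ ((l : Fin L) : ℕ) :=
    hli.comp (fun l : κ => (l : Fin L)) Subtype.val_injective
  obtain ⟨f, hf⟩ := exists_det_ne_zero_of_linearIndependent _ hli'
  let M : Matrix κ κ (Polynomial ℂ) := Matrix.of fun i l =>
    (Q l).comp (Polynomial.X + Polynomial.C (x (f i))) * Polynomial.C (w (f i) ^ ((l : Fin L) : ℕ))
  let d : κ → ℕ := fun l => (Q l).natDegree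
  have hcompd : ∀ (q : Polynomial ℂ) (c : ℂ),
      (q.comp (Polynomial.X + Polynomial.C c)).natDegree = q.natDegree := by
    intro q c; rw [Polynomial.natDegree_comp]; simp
  have hMd : ∀ i j, (M i j).natDegree ≤ d j := by
    intro i j
    refine (Polynomial.natDegree_mul_C_le _ _).trans ?_
    exact (hcompd _ _).le
  have hcoeff : (Matrix.of fun i j => (M i j).coeff (d j)).det ≠ 0 := by
    have h1 : (Matrix.of fun i j => (M i j).coeff (d j)) = Matrix.of fun (i j : κ) =>
        (Q j).leadingCoeff * (Matrix.of fun (j : κ) (i : κ) => w (f i) ^ ((j : Fin L) : ℕ)).transpose i j := by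
      ext i j
      simp only [M, d, Matrix.of_apply, Polynomial.coeff_mul_C, Matrix.transpose_apply]
      congr 1
      have := Polynomial.leadingCoeff_comp (p := Q j)
        (q := Polynomial.X + Polynomial.C (x (f i))) (by simp)
      rw [Polynomial.leadingCoeff, hcompd] at this
      simpa using this
    rw [h1, Matrix.det_mul_row, Matrix.det_transpose]
    refine mul_ne_zero (prod_ne_zero_iff.mpr fun j _ => ?_) hf
    exact Polynomial.leadingCoeff_ne_zero.mpr j.2
  have hdet0 : M.det ≠ 0 := by
    intro h0
    apply hcoeff
    rw [← Polynomial.coeff_det_sum M d hMd, h0, Polynomial.coeff_zero]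
  apply hdet0
  refine Polynomial.eq_zero_of_natDegree_lt_card_of_eval_eq_zero' _ (E₂.image x) ?_ ?_
  · intro z hz
    obtain ⟨h, hh, rfl⟩ := mem_image.mp hz
    rw [← Polynomial.coe_evalRingHom, RingHom.map_det]
    refine Matrix.exists_mulVec_eq_zero_iff.mp ⟨fun l : κ => w h ^ ((l : Fin L) : ℕ), ?_, ?_⟩
    · intro h0
      exact pow_ne_zero _ (hw0 h) (congrFun h0 ⟨l₀, hl₀⟩)
    · ext i
      have h1 := hv (f i) (f i).2 h hh
      rw [← sum_filter_add_sum_filter_not univ (fun l => Q l ≠ 0)] at h1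
      rw [sum_eq_zero (s := univ.filter fun l => ¬ Q l ≠ 0)
        (fun l hl => by simp at hl; simp [hl]), add_zero] at h1
      simp only [Matrix.mulVec, dotProduct, Pi.zero_apply]
      rw [← h1, ← sum_subtype_eq_sum_filter, subtype_univ]
      refine sum_congr rfl fun l _ => ?_
      simp [M, hw, mul_pow, add_comm]
      ring
  · refine lt_of_le_of_lt (Polynomial.natDegree_det_le_sum M d hMd) (lt_of_le_of_lt ?_ h₂)
    calc ∑ l, d l ≤ ∑ l : κ, D := sum_le_sum fun l _ => hdeg l
      _ = Fintype.card κ * D := by simp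
      _ ≤ L * D := by
        gcongr
        exact (Fintype.card_subtype_le fun l : Fin L => Q l ≠ 0).trans (by simp)

/-- The polynomial `z ↦ z (z - 1) ⋯ (z - k + 1) / k!`. -/
noncomputable def binomialPoly (k : ℕ) : Polynomial ℂ :=
  Polynomial.C ((k.factorial : ℂ)⁻¹) * descPochhammer ℂ k

theorem binomialPoly_natDegree (k : ℕ) : (binomialPoly k).natDegree = k := by
  rw [binomialPoly, Polynomial.natDegree_C_mul (by simpa using k.factorial_ne_zero), descPochhammer_natDegree]

theorem binomialPoly_eval (k : ℕ) (z : ℂ) :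
    (binomialPoly k).eval z = (k.factorial : ℂ)⁻¹ * ∏ j ∈ range k, (z - j) := by
  rw [binomialPoly, Polynomial.eval_C_mul, descPochhammer_eval_eq_prod_range]

theorem binomialPoly_eval_intCast (k : ℕ) (z : ℤ) :
    (binomialPoly k).eval (z : ℂ) = (Ring.choose z k : ℤ) := by
  have h := Ring.descPochhammer_eq_factorial_smul_choose z k
  rw [← Polynomial.eval_eq_smeval, descPochhammer_eval_eq_prod_range] at h
  have h' : ∏ j ∈ range k, ((z : ℂ) - j) = k.factorial * (Ring.choose z k : ℤ) := by
    have := congrArg (fun t : ℤ => (t : ℂ)) h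
    push_cast [nsmul_eq_mul] at this
    exact this
  rw [binomialPoly_eval, h']
  exact inv_mul_cancel_left₀ (by exact_mod_cast k.factorial_ne_zero) _

theorem linearIndependent_binomialPoly : LinearIndependent ℂ binomialPoly :=
  Polynomial.Sequence.linearIndependent
    ⟨binomialPoly, fun k => by
      rw [Polynomial.degree_eq_natDegree, binomialPoly_natDegree]
      rw [binomialPoly]
      exact mul_ne_zero (by simpa using k.factorial_ne_zero) (monic_descPochhammer ℂ k).ne_zero⟩

theorem norm_binomialPoly_eval_le (k K : ℕ) (hk : k ≤ K) (z : ℂ) (t : ℝ) (hz : ‖z‖ ≤ t) :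
    ‖(binomialPoly k).eval z‖ ≤ (t + K) ^ k / k.factorial := by
  rw [binomialPoly_eval, norm_mul, norm_inv, div_eq_inv_mul, norm_prod]
  have h : ∏ j ∈ range k, ‖z - j‖ ≤ ∏ j ∈ range k, (t + K) := by
    refine prod_le_prod (fun _ _ => norm_nonneg _) fun j hj => (norm_sub_le _ _).trans ?_
    have : (j : ℝ) ≤ K := by exact_mod_cast (mem_range.mp hj).le.trans hk
    simp only [Complex.norm_natCast]
    linarith
  simp only [prod_const, card_range] at h
  simp only [Complex.norm_natCast]
  gcongr

namespace Polynomial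

/-- Coefficientwise domination of a complex polynomial by a real one. -/
def MajorizedBy (P : Polynomial ℂ) (Q : Polynomial ℝ) : Prop := ∀ n, ‖P.coeff n‖ ≤ Q.coeff n

theorem MajorizedBy.mul {P₁ P₂ : Polynomial ℂ} {Q₁ Q₂ : Polynomial ℝ} (h₁ : P₁.MajorizedBy Q₁)
    (h₂ : P₂.MajorizedBy Q₂) : (P₁ * P₂).MajorizedBy (Q₁ * Q₂) := by
  intro n
  rw [coeff_mul, coeff_mul]
  refine (norm_sum_le _ _).trans (sum_le_sum fun x _ => ?_)
  rw [norm_mul]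
  exact mul_le_mul (h₁ _) (h₂ _) (norm_nonneg _) ((norm_nonneg _).trans (h₁ _))

theorem MajorizedBy.prod {ι : Type*} (s : Finset ι) {P : ι → Polynomial ℂ} {Q : ι → Polynomial ℝ}
    (h : ∀ i, (P i).MajorizedBy (Q i)) : (∏ i ∈ s, P i).MajorizedBy (∏ i ∈ s, Q i) := by
  classical
  induction s using Finset.induction_on with
  | empty => intro n; simp only [prod_empty, coeff_one]; split_ifs <;> simp
  | insert i s hi ih => rw [prod_insert hi, prod_insert hi]; exact (h i).mul ih

theorem MajorizedBy.sum {ι : Type*} (s : Finset ι) {P : ι → Polynomial ℂ} {Q : ι → Polynomial ℝ}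
    (h : ∀ i, (P i).MajorizedBy (Q i)) : (∑ i ∈ s, P i).MajorizedBy (∑ i ∈ s, Q i) := by
  intro n
  rw [finsetSum_coeff, finsetSum_coeff]
  exact (norm_sum_le _ _).trans (sum_le_sum fun i _ => h i n)

theorem majorizedBy_monomial (n : ℕ) (c : ℂ) : (monomial n c).MajorizedBy (monomial n ‖c‖) := by
  intro k
  rw [coeff_monomial, coeff_monomial]
  split_ifs <;> simp

theorem majorizedBy_X_sub_natCast (j : ℕ) :
    (X - C (j : ℂ)).MajorizedBy (X + C (j : ℝ)) := by
  intro n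
  rw [coeff_sub, coeff_add]
  refine (norm_sub_le _ _).trans (add_le_add ?_ ?_)
  · rw [coeff_X, coeff_X]; split_ifs <;> simp
  · rw [coeff_C, coeff_C]; split_ifs <;> simp

theorem MajorizedBy.sum_norm_coeff_le {P : Polynomial ℂ} {Q : Polynomial ℝ} (h : P.MajorizedBy Q)
    (t : ℝ) (ht : 0 ≤ t) (T : ℕ) : ∑ n ∈ range T, ‖P.coeff n‖ * t ^ n ≤ Q.eval t := by
  have hQ : ∀ n, 0 ≤ Q.coeff n := fun n => (norm_nonneg _).trans (h n)
  calc _ ≤ ∑ n ∈ range T, Q.coeff n * t ^ n := sum_le_sum fun n _ => by gcongr; exact h n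
    _ ≤ ∑ n ∈ range (max T (Q.natDegree + 1)), Q.coeff n * t ^ n := by
      refine sum_le_sum_of_subset_of_nonneg (range_mono (le_max_left _ _)) fun n _ _ => ?_
      have := hQ n
      positivity
    _ = _ := (eval_eq_sum_range' (by omega) t).symm

end Polynomial

open Polynomial in
theorem exists_polynomial_approx_binomialPoly_mul_exp (k K : ℕ) (hk : k ≤ K) (c : ℂ) (X t ε : ℝ)
    (hX : 0 ≤ X) (hXt : X ≤ t) (hε : 0 < ε) :
    ∃ P : Polynomial ℂ,
      (∀ T : ℕ, ∑ n ∈ range T, ‖P.coeff n‖ * t ^ n ≤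
        (t + K) ^ k / k.factorial * Real.exp (‖c‖ * t)) ∧
      ∀ z : ℂ, ‖z‖ ≤ X → ‖(binomialPoly k).eval z * Complex.exp (c * z) - P.eval z‖ ≤
        ε * ((t + K) ^ k / k.factorial) := by
  have ht : 0 ≤ t := hX.trans hXt
  set B := ‖c‖ * X with hB
  have hB0 : 0 ≤ B := by positivity
  obtain ⟨n, hn1, hn2⟩ : ∃ n : ℕ, B ^ n / n.factorial * 2 ≤ ε ∧ B / n.succ ≤ 1 / 2 := by
    have h1 := (FloorSemiring.tendsto_pow_div_factorial_atTop B).eventually_le_const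
      (show (0 : ℝ) < ε / 2 by positivity)
    have h2 := Filter.eventually_ge_atTop ⌈2 * B⌉₊
    obtain ⟨n, hn1, hn2⟩ := (h1.and h2).exists
    refine ⟨n, by linarith, ?_⟩
    rw [div_le_iff₀ (by positivity)]
    have : 2 * B ≤ n := (Nat.le_ceil _).trans (by exact_mod_cast hn2)
    push_cast
    linarith
  let E : Polynomial ℂ := ∑ i ∈ range n, monomial i (c ^ i / i.factorial)
  let E' : Polynomial ℝ := ∑ i ∈ range n, monomial i ‖c ^ i / (i.factorial : ℂ)‖
  let D : Polynomial ℂ := monomial 0 ((k.factorial : ℂ)⁻¹) * ∏ j ∈ range k, (Polynomial.X - C (j : ℂ))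
  let D' : Polynomial ℝ :=
    monomial 0 ‖(k.factorial : ℂ)⁻¹‖ * ∏ j ∈ range k, (Polynomial.X + C (j : ℝ))
  have hD : ∀ z, D.eval z = (binomialPoly k).eval z := by
    intro z
    simp [D, binomialPoly_eval, eval_prod]
  have hDm : D.MajorizedBy D' :=
    (majorizedBy_monomial _ _).mul (MajorizedBy.prod _ fun j => majorizedBy_X_sub_natCast j)
  have hEm : E.MajorizedBy E' := MajorizedBy.sum _ fun i => majorizedBy_monomial _ _
  have hD't : D'.eval t ≤ (t + K) ^ k / k.factorial := by
    simp only [D', eval_mul, eval_monomial, eval_prod, eval_add, eval_X, eval_C, pow_zero, mul_one,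
      norm_inv, Complex.norm_natCast]
    rw [div_eq_inv_mul]
    gcongr
    calc ∏ j ∈ range k, (t + j) ≤ ∏ j ∈ range k, (t + K) := by
          refine prod_le_prod (fun _ _ => by positivity) fun j hj => ?_
          have : (j : ℝ) ≤ K := by exact_mod_cast (mem_range.mp hj).le.trans hk
          linarith
      _ = _ := by simp
  have hE't : E'.eval t ≤ Real.exp (‖c‖ * t) := by
    have h := Real.sum_le_exp_of_nonneg (x := ‖c‖ * t) (by positivity) n
    refine le_trans (le_of_eq ?_) h
    simp only [E', eval_finsetSum, eval_monomial]
    refine sum_congr rfl fun i _ => ?_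
    simp [mul_pow]
    ring
  have hE'0 : 0 ≤ E'.eval t := by
    simp only [E', eval_finsetSum, eval_monomial]
    exact sum_nonneg fun i _ => by positivity
  refine ⟨D * E, fun T => ?_, fun z hz => ?_⟩
  · refine ((hDm.mul hEm).sum_norm_coeff_le t ht T).trans ?_
    rw [eval_mul]
    exact mul_le_mul hD't hE't hE'0 (by positivity)
  · rw [eval_mul, hD, ← mul_sub, norm_mul, mul_comm]
    have hcz : ‖c * z‖ ≤ B := by rw [norm_mul, hB]; gcongr
    have h1 : ‖Complex.exp (c * z) - E.eval z‖ ≤ ε := by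
      have h2 : E.eval z = ∑ m ∈ range n, (c * z) ^ m / m.factorial := by
        simp only [E, eval_finsetSum, eval_monomial]
        refine sum_congr rfl fun i _ => ?_
        rw [mul_pow]; ring
      rw [h2]
      refine (Complex.exp_bound' ((div_le_div_of_nonneg_right hcz (by positivity)).trans hn2)).trans
        (le_trans ?_ hn1)
      gcongr
    exact mul_le_mul h1 (norm_binomialPoly_eval_le k K hk z t (hz.trans hXt)) (norm_nonneg _) hε.le

set_option maxHeartbeats 800000 in
/-- A grid of points on which binomial polynomials times powers of a character are independent. -/
theorem linearIndependent_binomialPoly_mul_zpow (p K R S : ℕ) (j : ℤ) (γ : ℂ) (hp : p.Prime)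
    (hp2 : 2 < p) (hj : ¬ (p : ℤ) ∣ j) (hγ0 : γ ≠ 0)
    (hroot : ∀ r s : ℤ, γ ^ r * Complex.I ^ s = 1 → r = 0)
    (hK : 1 ≤ K) (hR : 1 ≤ R) (hRp : 2 * R ≤ p) (hcount : 9 * (K - 1) < (2 * R - 1) * (2 * S)) :
    LinearIndependent ℂ fun (i : Fin K × Fin 9)
      (g : {g : ℤ × ℤ // |g.1| ≤ R ∧ |4 * j * g.1 + p * g.2| ≤ (S + 2) * p}) =>
      (binomialPoly i.1).eval ((4 * j * g.1.1 + p * g.1.2 : ℤ) : ℂ) *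
        (γ ^ g.1.1 * Complex.I ^ g.1.2) ^ ((i.2 : ℤ) - 4) := by
  classical
  have hp0 : (0 : ℤ) < p := by exact_mod_cast hp.pos
  rw [Fintype.linearIndependent_iff]
  intro c hc
  let x : ℤ × ℤ →+ ℂ :=
    { toFun := fun g => ((4 * j * g.1 + p * g.2 : ℤ) : ℂ)
      map_zero' := by simp
      map_add' := fun g h => by simp only [Prod.fst_add, Prod.snd_add]; push_cast; ring }
  let w : ℤ × ℤ → ℂ := fun g => γ ^ g.1 * Complex.I ^ g.2
  have hw0 : ∀ g, w g ≠ 0 := fun g =>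
    mul_ne_zero (zpow_ne_zero _ hγ0) (zpow_ne_zero _ Complex.I_ne_zero)
  have hw : ∀ g h, w (g + h) = w g * w h := by
    intro g h
    simp only [w, Prod.fst_add, Prod.snd_add, zpow_add₀ hγ0, zpow_add₀ Complex.I_ne_zero]
    ring
  let Q : Fin 9 → Polynomial ℂ := fun l => ∑ k : Fin K, c (k, l) • binomialPoly k
  have hQdeg : ∀ l, (Q l).natDegree ≤ K - 1 := by
    intro l
    refine Polynomial.natDegree_sum_le_of_forall_le _ _ fun k _ => ?_
    refine (Polynomial.natDegree_smul_le _ _).trans ?_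
    rw [binomialPoly_natDegree]
    omega
  let φ : ℤ × ℤ → ℤ × ℤ := fun q => (q.1, q.2 - 4 * j * q.1 / p)
  have hφ : ∀ q : ℤ × ℤ, 4 * j * (φ q).1 + p * (φ q).2 = 4 * j * q.1 % p + p * q.2 := by
    intro q
    have := Int.emod_add_mul_ediv (4 * j * q.1) p
    simp only [φ]
    linarith [mul_sub (p : ℤ) q.2 (4 * j * q.1 / p)]
  have hmod : ∀ r : ℤ, 0 ≤ 4 * j * r % p ∧ 4 * j * r % p < p := fun r =>
    ⟨Int.emod_nonneg _ hp0.ne', Int.emod_lt_of_pos _ hp0⟩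
  let E₁ : Finset (ℤ × ℤ) := (Icc (-1) 1 ×ˢ Icc (-2) 1).image φ
  let E₂ : Finset (ℤ × ℤ) := (Icc (-((R : ℤ) - 1)) (R - 1) ×ˢ Ico (-(S : ℤ)) S).image φ
  have hI4 : ∀ t : ℤ, -3 ≤ t → t ≤ 3 → Complex.I ^ t = 1 → t = 0 := by
    intro t h1 h2 h3
    have h4 := (Complex.isPrimitiveRoot_I).zpow_eq_one_iff_dvd t |>.mp h3
    omega
  have hE₁ : 9 ≤ (E₁.image w).card := by
    rw [image_image, card_image_of_injOn]
    · simp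
    · intro q hq q' hq' hqq
      simp only [coe_product, coe_Icc, Set.mem_prod, Set.mem_Icc] at hq hq'
      have h1 : w (φ q - φ q') = 1 := by
        have := hw (φ q - φ q') (φ q')
        rw [sub_add_cancel] at this
        have h2 : w (φ q) = w (φ q') := hqq
        rw [h2] at this
        exact (mul_eq_right₀ (hw0 _)).mp this.symm
      have h2 := hroot _ _ h1
      have h3 : q.1 = q'.1 := by simpa [φ, sub_eq_zero] using h2
      simp only [w, h2, zpow_zero, one_mul] at h1
      have h4 : (φ q - φ q').2 = q.2 - q'.2 := by simp [φ, h3]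
      rw [h4] at h1
      have := hI4 _ (by omega) (by omega) h1
      exact Prod.ext h3 (by omega)
  have hE₂ : 9 * (K - 1) < (E₂.image x).card := by
    rw [image_image, card_image_of_injOn]
    · rw [card_product, Int.card_Icc, Int.card_Ico]
      convert hcount using 2 <;> omega
    · intro q hq q' hq' hqq
      simp only [coe_product, coe_Icc, coe_Ico, Set.mem_prod, Set.mem_Icc, Set.mem_Ico] at hq hq'
      have h1 : 4 * j * (φ q).1 + p * (φ q).2 = 4 * j * (φ q').1 + p * (φ q').2 := by
        have : ((4 * j * (φ q).1 + p * (φ q).2 : ℤ) : ℂ) =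
          ((4 * j * (φ q').1 + p * (φ q').2 : ℤ) : ℂ) := hqq
        exact Int.cast_injective this
      have h3 : q.1 = q'.1 := by
        have hd : (p : ℤ) ∣ 4 * j * (q.1 - q'.1) := by
          refine ⟨(φ q').2 - (φ q).2, ?_⟩
          simp only [φ] at h1 ⊢
          linarith
        have hpp : Prime (p : ℤ) := Nat.prime_iff_prime_int.mp hp
        rcases hpp.dvd_or_dvd hd with h | h
        · rcases hpp.dvd_or_dvd h with h | h
          · have h' : p ∣ 2 ^ 2 := by exact_mod_cast h
            have := Nat.le_of_dvd (by norm_num) (hp.dvd_of_dvd_pow h')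
            omega
          · exact absurd h hj
        · have := Int.eq_zero_of_abs_lt_dvd h (by rw [abs_lt]; omega)
          omega
      have h5 : 4 * j * q.1 % p = 4 * j * q'.1 % p := by rw [h3]
      have h7 : (p : ℤ) * q.2 = p * q'.2 := by linarith [hφ q, hφ q']
      exact Prod.ext h3 (mul_left_cancel₀ hp0.ne' h7)
  have hzero := eq_zero_of_forall_sum_eval_mul_pow_eq_zero x w hw hw0 (K - 1) 9 Q hQdeg E₁ E₂ hE₁ hE₂
    (by
      intro g hg h hh
      obtain ⟨q, hq, rfl⟩ := mem_image.mp hg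
      obtain ⟨q', hq', rfl⟩ := mem_image.mp hh
      simp only [mem_product, mem_Icc, mem_Ico] at hq hq'
      have hb : |(φ q + φ q').1| ≤ R ∧
          |4 * j * (φ q + φ q').1 + p * (φ q + φ q').2| ≤ (S + 2) * p := by
        constructor
        · simp only [φ, Prod.fst_add]; rw [abs_le]; omega
        · have h1 : 4 * j * (φ q + φ q').1 + p * (φ q + φ q').2 =
              (4 * j * q.1 % p + 4 * j * q'.1 % p) + p * (q.2 + q'.2) := by
            have := hφ q
            have := hφ q'
            simp only [Prod.fst_add, Prod.snd_add]
            linarith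
          rw [h1, abs_le]
          have h2 := hmod q.1
          have h3 := hmod q'.1
          have h4 := mul_le_mul_of_nonneg_left (show q.2 + q'.2 ≤ S by omega) hp0.le
          have h5 := mul_le_mul_of_nonneg_left (show -((S : ℤ) + 2) ≤ q.2 + q'.2 by omega) hp0.le
          constructor <;> linarith
      have := congrFun hc ⟨_, hb⟩
      simp only [Finset.sum_apply, Pi.smul_apply, smul_eq_mul, Pi.zero_apply] at this
      rw [Fintype.sum_prod_type_right] at this
      have hmul := congrArg (fun t => t * w (φ q + φ q') ^ (4 : ℤ)) this
      simp only [zero_mul] at hmul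
      rw [← hmul, sum_mul]
      refine sum_congr rfl fun l _ => ?_
      have hpow : w (φ q + φ q') ^ (l : ℕ) =
          w (φ q + φ q') ^ ((l : ℤ) - 4) * w (φ q + φ q') ^ (4 : ℤ) := by
        rw [← zpow_add₀ (hw0 _)]; simp
      rw [hpow, sum_mul]
      simp only [Q, Polynomial.eval_finsetSum, Polynomial.eval_smul, smul_eq_mul, sum_mul]
      refine sum_congr rfl fun k _ => ?_
      simp only [x, w, AddMonoidHom.coe_mk, ZeroHom.coe_mk]
      ring)
  rintro ⟨k, l⟩
  have hind : LinearIndependent ℂ fun k : Fin K => binomialPoly k :=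
    linearIndependent_binomialPoly.comp (fun k : Fin K => (k : ℕ)) Fin.val_injective
  exact Fintype.linearIndependent_iff.mp hind (fun k => c (k, l)) (hzero l) k

theorem one_le_norm_of_mem_range_toComplex (z : ℂ) (hz : z ∈ GaussianInt.toComplex.range)
    (h0 : z ≠ 0) : 1 ≤ ‖z‖ := by
  obtain ⟨g, rfl⟩ := hz
  have hg : g ≠ 0 := by rintro rfl; simp at h0
  have h1 : (1 : ℝ) ≤ (g.norm : ℝ) := by
    exact_mod_cast Int.add_one_le_iff.mpr (GaussianInt.norm_pos.mpr hg)
  rw [GaussianInt.intCast_real_norm, Complex.normSq_eq_norm_sq] at h1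
  nlinarith [norm_nonneg (GaussianInt.toComplex g)]

theorem normSq_pow_mul_zpow_mem_range_toComplex (g : GaussianInt) (hg : g ≠ 0) (e : ℤ) (n : ℕ)
    (he : |e| ≤ n) :
    (Complex.normSq (g : ℂ) : ℂ) ^ n * (starRingEnd ℂ (g : ℂ) / g) ^ e ∈
      GaussianInt.toComplex.range := by
  have h0 : (g : ℂ) ≠ 0 := by simpa using hg
  have h1 : starRingEnd ℂ (g : ℂ) ≠ 0 := by simpa using hg
  obtain ⟨u, hu⟩ := Int.eq_ofNat_of_zero_le (show 0 ≤ (n : ℤ) - e by linarith [le_abs_self e])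
  obtain ⟨v, hv⟩ := Int.eq_ofNat_of_zero_le (show 0 ≤ (n : ℤ) + e by linarith [neg_abs_le e])
  refine ⟨g ^ u * star g ^ v, ?_⟩
  rw [map_mul, map_pow, map_pow, GaussianInt.toComplex_star,
    Complex.normSq_eq_conj_mul_self, div_zpow, mul_pow]
  rw [← zpow_natCast _ u, ← zpow_natCast _ v, ← hu, ← hv, zpow_sub₀ h0, zpow_add₀ h1,
    zpow_natCast, zpow_natCast]
  field_simp

theorem one_le_norm_det_of_mem_range_toComplex {ι : Type*} [Fintype ι] [DecidableEq ι]
    (M : Matrix ι ι ℂ) (hM : ∀ i j, M i j ∈ GaussianInt.toComplex.range) (h0 : M.det ≠ 0) :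
    1 ≤ ‖M.det‖ := by
  refine one_le_norm_of_mem_range_toComplex _ ?_ h0
  choose A hA using hM
  refine ⟨(Matrix.of A).det, ?_⟩
  rw [RingHom.map_det]
  congr 1
  ext i j
  simp [hA]

theorem I_zpow_mem_range_toComplex (s : ℤ) : Complex.I ^ s ∈ GaussianInt.toComplex.range := by
  obtain ⟨n, hn⟩ : ∃ n : ℕ, Complex.I ^ s = Complex.I ^ n := by
    refine ⟨(s % 4).toNat, ?_⟩
    rw [← zpow_natCast, Int.toNat_of_nonneg (Int.emod_nonneg _ (by norm_num))]
    conv_lhs => rw [← Int.emod_add_mul_ediv s 4, zpow_add₀ Complex.I_ne_zero, zpow_mul]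
    have : Complex.I ^ (4 : ℤ) = 1 := by
      rw [show (4 : ℤ) = ((4 : ℕ) : ℤ) by norm_num, zpow_natCast]; exact Complex.I_pow_four
    simp [this]
  rw [hn]
  have hI : Complex.I ∈ GaussianInt.toComplex.range := ⟨⟨0, 1⟩, by simp [GaussianInt.toComplex_def]⟩
  exact Subring.pow_mem _ hI n

/-- The interpolation determinant of `binomialPoly k * w ^ (l - 4)` at points of the grid. -/
theorem one_le_normSq_pow_mul_norm_det (g : GaussianInt) (hg : g ≠ 0) (K R : ℕ)
    (x : Fin K × Fin 9 → ℤ) (r s : Fin K × Fin 9 → ℤ) (hr : ∀ i, |r i| ≤ R)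
    (hdet : (Matrix.of fun i i' : Fin K × Fin 9 => (binomialPoly i.1).eval ((x i' : ℤ) : ℂ) *
      ((starRingEnd ℂ (g : ℂ) / g) ^ r i' * Complex.I ^ s i') ^ ((i.2 : ℤ) - 4)).det ≠ 0) :
    1 ≤ Complex.normSq (g : ℂ) ^ (20 * K * R) *
      ‖(Matrix.of fun i i' : Fin K × Fin 9 => (binomialPoly i.1).eval ((x i' : ℤ) : ℂ) *
      ((starRingEnd ℂ (g : ℂ) / g) ^ r i' * Complex.I ^ s i') ^ ((i.2 : ℤ) - 4)).det‖ := by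
  set M : Matrix (Fin K × Fin 9) (Fin K × Fin 9) ℂ :=
    Matrix.of fun i i' : Fin K × Fin 9 => (binomialPoly i.1).eval ((x i' : ℤ) : ℂ) *
      ((starRingEnd ℂ (g : ℂ) / g) ^ r i' * Complex.I ^ s i') ^ ((i.2 : ℤ) - 4) with hM
  set v : Fin K × Fin 9 → ℂ := fun i =>
    (Complex.normSq (g : ℂ) : ℂ) ^ (R * ((i.2 : ℤ) - 4).natAbs) with hv
  have hprod : ∏ i, v i = (Complex.normSq (g : ℂ) : ℂ) ^ (20 * K * R) := by
    simp only [hv]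
    rw [Finset.prod_pow_eq_pow_sum]
    congr 1
    rw [← Finset.mul_sum, Fintype.sum_prod_type]
    have : ∑ l : Fin 9, ((l : ℤ) - 4).natAbs = 20 := by decide
    simp [this]
    ring
  have h0 : (Complex.normSq (g : ℂ) : ℂ) ≠ 0 := by simpa using hg
  have hdet' : (Matrix.of fun i j => v i * M i j).det =
      (Complex.normSq (g : ℂ) : ℂ) ^ (20 * K * R) * M.det := by
    rw [← hprod]; exact Matrix.det_mul_column v M
  have key := one_le_norm_det_of_mem_range_toComplex (Matrix.of fun i j => v i * M i j) ?_ ?_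
  · rw [hdet', norm_mul, norm_pow, Complex.norm_real, Real.norm_of_nonneg (Complex.normSq_nonneg _)]
      at key
    exact key
  · intro i i'
    simp only [Matrix.of_apply, hM, hv]
    rw [mul_zpow, ← zpow_mul, ← zpow_mul, binomialPoly_eval_intCast]
    have h1 := normSq_pow_mul_zpow_mem_range_toComplex g hg (r i' * ((i.2 : ℤ) - 4))
      (R * ((i.2 : ℤ) - 4).natAbs) (by
        rw [abs_mul]; push_cast
        exact mul_le_mul_of_nonneg_right (hr i') (abs_nonneg _))
    have h2 := I_zpow_mem_range_toComplex (s i' * ((i.2 : ℤ) - 4))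
    have h3 : ((Ring.choose (x i') (i.1 : ℕ) : ℤ) : ℂ) ∈ GaussianInt.toComplex.range :=
      ⟨(Ring.choose (x i') (i.1 : ℕ) : ℤ), by simp⟩
    have := Subring.mul_mem _ (Subring.mul_mem _ h1 h2) h3
    convert this using 1
    ring
  · rw [hdet']
    exact mul_ne_zero (pow_ne_zero _ h0) hdet

theorem exp_zpow_mul_I_zpow_zpow (p : ℕ) (hp : p ≠ 0) (j r s m : ℤ) (δ : ℝ) :
    (Complex.exp ((2 * Real.pi * j / p + δ : ℝ) * Complex.I) ^ r * Complex.I ^ s) ^ m =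
      Complex.exp ((m * (Real.pi / (2 * p)) : ℝ) * Complex.I * (4 * j * r + p * s : ℤ)) *
        Complex.exp ((m * r * δ : ℝ) * Complex.I) := by
  have hI : Complex.I = Complex.exp (Real.pi / 2 * Complex.I) := Complex.exp_pi_div_two_mul_I.symm
  conv_lhs => rw [show Complex.I ^ s = (Complex.exp (Real.pi / 2 * Complex.I)) ^ s by rw [← hI]]
  rw [← Complex.exp_int_mul, ← Complex.exp_int_mul, ← Complex.exp_add, ← Complex.exp_int_mul,
    ← Complex.exp_add]
  congr 1
  have : (p : ℂ) ≠ 0 := by exact_mod_cast hp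
  push_cast
  field_simp
  ring

theorem norm_det_mul_exp_le (p K R : ℕ) (j : ℤ) (δ X : ℝ) (hp : p ≠ 0) (hX : 0 ≤ X)
    (hδ : 4 * R * |δ| ≤ Real.exp (-(2 * (9 * K))) / 2)
    (r s : Fin K × Fin 9 → ℤ) (hr : ∀ i, |r i| ≤ R) (hx : ∀ i, |((4 * j * r i + p * s i : ℤ) : ℝ)| ≤ X) :
    ‖(Matrix.of fun i i' : Fin K × Fin 9 =>
      (binomialPoly i.1).eval ((4 * j * r i' + p * s i' : ℤ) : ℂ) *
      (Complex.exp ((2 * Real.pi * j / p + δ : ℝ) * Complex.I) ^ r i' * Complex.I ^ s i') ^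
        ((i.2 : ℤ) - 4)).det‖ * Real.exp 2 ^ (9 * K * (9 * K - 1) / 2) ≤
      (9 * K).factorial * ∏ i : Fin K × Fin 9, (2 * ((Real.exp 2 * X + K) ^ (i.1 : ℕ) /
        (i.1 : ℕ).factorial * Real.exp (|((i.2 : ℤ) - 4 : ℝ)| * (Real.pi / (2 * p)) *
          (Real.exp 2 * X)))) := by
  have hcard : Fintype.card (Fin K × Fin 9) = 9 * K := by simp [mul_comm]
  have hρ : 1 ≤ Real.exp 2 := Real.one_le_exp (by norm_num)
  set t := Real.exp 2 * X with ht
  have hXt : X ≤ t := le_mul_of_one_le_left hX hρ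
  set ε := Real.exp (-(2 * (9 * K))) / 2 with hε
  have hε0 : 0 < ε := by positivity
  set c : Fin 9 → ℂ := fun l =>
    (((((l : ℕ) : ℤ) - 4 : ℤ) : ℝ) * (Real.pi / (2 * p)) : ℝ) * Complex.I with hc
  have hcn : ∀ l, ‖c l‖ = |(((l : ℕ) : ℤ) - 4 : ℝ)| * (Real.pi / (2 * p)) := by
    intro l
    simp only [hc]
    rw [norm_mul, Complex.norm_I, mul_one, Complex.norm_real, Real.norm_eq_abs, abs_mul,
      abs_of_nonneg (show 0 ≤ Real.pi / (2 * p) by positivity)]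
    push_cast
    rfl
  choose P hP1 hP2 using fun i : Fin K × Fin 9 =>
    exists_polynomial_approx_binomialPoly_mul_exp i.1 K i.1.2.le (c i.2) X t ε hX hXt hε0
  set T := (univ.sup fun i => (P i).natDegree) + 1 with hT
  set x : Fin K × Fin 9 → ℂ := fun i => ((4 * j * r i + p * s i : ℤ) : ℂ) with hxdef
  have hxX : ∀ i, ‖x i‖ ≤ X := by
    intro i
    simp only [hxdef]
    rw [Complex.norm_intCast]
    exact hx i
  set M : Matrix (Fin K × Fin 9) (Fin K × Fin 9) ℂ := Matrix.of fun i i' =>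
      (binomialPoly i.1).eval (x i') *
      (Complex.exp ((2 * Real.pi * j / p + δ : ℝ) * Complex.I) ^ r i' * Complex.I ^ s i') ^
        ((i.2 : ℤ) - 4) with hM
  have hPeval : ∀ i z, (P i).eval z = ∑ n : Fin T, (P i).coeff n * z ^ (n : ℕ) := by
    intro i z
    rw [Fin.sum_univ_eq_sum_range (fun n => (P i).coeff n * z ^ n)]
    refine Polynomial.eval_eq_sum_range' ?_ z
    exact Nat.lt_succ_of_le (Finset.le_sup (f := fun i => (P i).natDegree) (mem_univ i))
  set F : Fin K × Fin 9 → ℝ := fun i => (t + K) ^ (i.1 : ℕ) / (i.1 : ℕ).factorial *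
    Real.exp (|((i.2 : ℤ) - 4 : ℝ)| * (Real.pi / (2 * p)) * t) with hF
  have hMe : M = Matrix.of fun i i' => ∑ n : Fin T, (P i).coeff n * x i' ^ (n : ℕ) +
      (M i i' - (P i).eval (x i')) := by
    ext i i'
    rw [Matrix.of_apply, ← hPeval]
    ring
  have key := norm_interpolation_det_le T x (fun i n => (P i).coeff n)
    (fun i i' => M i i' - (P i).eval (x i')) F X (Real.exp 2) hX hρ hxX ?_ ?_
  · rw [← hMe, hcard] at key
    exact key
  · intro i
    rw [Fin.sum_univ_eq_sum_range (fun n => ‖(P i).coeff n‖ * (Real.exp 2 * X) ^ n)]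
    refine (hP1 i T).trans_eq ?_
    simp only [hF, hcn]
  · intro i i'
    have h1 : M i i' - (P i).eval (x i') =
        ((binomialPoly i.1).eval (x i') * Complex.exp (c i.2 * x i') - (P i).eval (x i')) +
        (binomialPoly i.1).eval (x i') * Complex.exp (c i.2 * x i') *
          (Complex.exp (((((i.2 : ℤ) - 4 : ℤ) : ℝ) * r i' * δ : ℝ) * Complex.I) - 1) := by
      simp only [hM, Matrix.of_apply]
      rw [exp_zpow_mul_I_zpow_zpow p hp]
      simp only [hc, hxdef]
      ring
    have h2 : ‖Complex.exp (c i.2 * x i')‖ = 1 := by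
      have : c i.2 * x i' = (((((i.2 : ℕ) : ℤ) - 4 : ℤ) : ℝ) * (Real.pi / (2 * p)) *
          (4 * j * r i' + p * s i' : ℤ) : ℝ) * Complex.I := by
        simp only [hc, hxdef]; push_cast; ring
      rw [this, Complex.norm_exp_ofReal_mul_I]
    have h3 : ‖Complex.exp (((((i.2 : ℤ) - 4 : ℤ) : ℝ) * r i' * δ : ℝ) * Complex.I) - 1‖ ≤ ε := by
      rw [mul_comm _ Complex.I]
      refine Real.norm_exp_I_mul_ofReal_sub_one_le.trans ?_
      refine le_trans ?_ hδ
      rw [Real.norm_eq_abs, abs_mul, abs_mul]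
      gcongr
      · have : |((i.2 : ℕ) : ℤ) - 4| ≤ 4 := by rw [abs_le]; omega
        exact_mod_cast this
      · exact_mod_cast hr i'
    have h4 : ‖(binomialPoly i.1).eval (x i')‖ ≤ (t + K) ^ (i.1 : ℕ) / (i.1 : ℕ).factorial :=
      norm_binomialPoly_eval_le _ _ i.1.2.le _ _ ((hxX i').trans hXt)
    set B := (t + K) ^ (i.1 : ℕ) / ((i.1 : ℕ).factorial : ℝ) with hB
    have hB0 : 0 ≤ B := (norm_nonneg _).trans h4
    have h5 : ‖M i i' - (P i).eval (x i')‖ ≤ Real.exp (-(2 * (9 * K))) * B := by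
      rw [h1]
      refine (norm_add_le _ _).trans ?_
      rw [norm_mul, norm_mul, h2, mul_one]
      have := mul_le_mul h4 h3 (norm_nonneg _) hB0
      have := hP2 i (x i') (hxX i')
      have : Real.exp (-(2 * (9 * K))) = 2 * ε := by rw [hε]; ring
      rw [this]
      linarith
    rw [hcard, ← Real.exp_nat_mul]
    calc _ ≤ Real.exp (-(2 * (9 * K))) * B * Real.exp ((9 * K : ℕ) * 2) := by gcongr
      _ = B * (Real.exp (-(2 * (9 * K))) * Real.exp ((9 * K : ℕ) * 2)) := by ring
      _ = B := by
        rw [← Real.exp_add]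
        have : -(2 * (9 * (K : ℝ))) + (9 * K : ℕ) * 2 = 0 := by push_cast; ring
        rw [this]; simp
      _ ≤ F i := by
        simp only [hF]
        refine le_mul_of_one_le_right hB0 (Real.one_le_exp ?_)
        have : 0 ≤ t := hX.trans hXt
        positivity

theorem pow_div_factorial_le_exp_mul (K k : ℕ) (hK : 0 < K) (u : ℝ) (hu : 0 ≤ u) :
    u ^ k / k.factorial ≤ Real.exp (K / 2) * (2 * u / K) ^ k := by
  have h := Real.pow_div_factorial_le_exp (K / 2 : ℝ) (by positivity) k
  have hK' : (0 : ℝ) < K := by exact_mod_cast hK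
  calc u ^ k / k.factorial = (K / 2 : ℝ) ^ k / k.factorial * (2 * u / K) ^ k := by
        rw [div_mul_eq_mul_div, ← mul_pow]
        congr 2
        field_simp
    _ ≤ _ := by gcongr

theorem log_prod_le (p K : ℕ) (hp : p ≠ 0) (hK : 0 < K) (t : ℝ) (ht : 0 ≤ t) :
    Real.log (∏ i : Fin K × Fin 9, (2 * ((t + K) ^ (i.1 : ℕ) /
        (i.1 : ℕ).factorial * Real.exp (|((i.2 : ℤ) - 4 : ℝ)| * (Real.pi / (2 * p)) * t)))) ≤
      9 * K * (Real.log 2 + K / 2 + (K - 1) / 2 * Real.log (2 * t / K + 2) +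
        10 / 9 * (Real.pi / p) * t) := by
  have hK' : (0 : ℝ) < K := by exact_mod_cast hK
  have hL : 0 < 2 * t / K + 2 := by positivity
  rw [Real.log_prod (fun i _ => by positivity)]
  have h1 : ∀ i : Fin K × Fin 9, Real.log (2 * ((t + K) ^ (i.1 : ℕ) /
        (i.1 : ℕ).factorial * Real.exp (|((i.2 : ℤ) - 4 : ℝ)| * (Real.pi / (2 * p)) * t))) ≤
      Real.log 2 + K / 2 + (i.1 : ℕ) * Real.log (2 * t / K + 2) +
        |((i.2 : ℤ) - 4 : ℝ)| * ((Real.pi / (2 * p)) * t) := by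
    intro i
    have h2 := pow_div_factorial_le_exp_mul K i.1 hK (t + K) (by positivity)
    have h3 : 2 * (t + K) / K = 2 * t / K + 2 := by field_simp
    rw [h3] at h2
    rw [Real.log_mul (by norm_num) (by positivity), Real.log_mul (by positivity) (by positivity),
      Real.log_exp]
    have h4 := Real.log_le_log (by positivity) h2
    rw [Real.log_mul (by positivity) (by positivity), Real.log_exp, Real.log_pow] at h4
    linarith
  refine (sum_le_sum fun i _ => h1 i).trans_eq ?_
  rw [Fintype.sum_prod_type]
  have h5 : ∑ l : Fin 9, |((l : ℤ) - 4 : ℝ)| = 20 := by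
    simp [Fin.sum_univ_succ]
    norm_num [abs_of_nonneg, abs_of_nonpos]
  have h6 : ∑ k : Fin K, ((k : ℕ) : ℝ) = K * (K - 1) / 2 := by
    rw [Fin.sum_univ_eq_sum_range (fun n => (n : ℝ)), ← Nat.cast_sum]
    have := Finset.sum_range_id_mul_two K
    have h7 : ((∑ i ∈ range K, i : ℕ) : ℝ) * 2 = K * (K - 1) := by
      have h8 : ((K - 1 : ℕ) : ℝ) = K - 1 := by rw [Nat.cast_sub hK]; simp
      rw [← h8]
      exact_mod_cast this
    linarith
  simp only [sum_add_distrib, ← sum_mul, ← mul_sum, sum_const, card_univ, Fintype.card_fin,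
    h5, nsmul_eq_mul, h6]
  push_cast
  field_simp
  ring

/-- The inequality coming from the interpolation determinant attached to `γ = conj g / g` and
a fourth root of unity. -/
theorem interpolation_inequality (g : GaussianInt) (hg : g ≠ 0) (p K R S : ℕ) (j : ℤ) (δ : ℝ)
    (hp : p.Prime) (hp2 : 2 < p) (hj : ¬ (p : ℤ) ∣ j)
    (hγ : starRingEnd ℂ (g : ℂ) / g = Complex.exp ((2 * Real.pi * j / p + δ : ℝ) * Complex.I))
    (hroot : ∀ r s : ℤ, (starRingEnd ℂ (g : ℂ) / g) ^ r * Complex.I ^ s = 1 → r = 0)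
    (hK : 1 ≤ K) (hR : 1 ≤ R) (hRp : 2 * R ≤ p) (hcount : 9 * (K - 1) < (2 * R - 1) * (2 * S))
    (hδ : 4 * R * |δ| ≤ Real.exp (-(2 * (9 * K))) / 2) :
    (9 * K - 1 : ℝ) ≤ 20 / 9 * R * Real.log (Complex.normSq (g : ℂ)) + Real.log (9 * K) +
      Real.log 2 + K / 2 + (K - 1) / 2 * Real.log (2 * (Real.exp 2 * ((S + 2) * p)) / K + 2) +
      10 / 9 * Real.pi * (Real.exp 2 * (S + 2)) := by
  have h0 : (g : ℂ) ≠ 0 := by simpa using hg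
  have h1 : starRingEnd ℂ (g : ℂ) ≠ 0 := by simpa using hg
  obtain ⟨f, hf⟩ := exists_det_ne_zero_of_linearIndependent _
    (linearIndependent_binomialPoly_mul_zpow p K R S j _ hp hp2 hj (div_ne_zero h1 h0) hroot
      hK hR hRp hcount)
  have hr : ∀ i, |(f i).1.1| ≤ R := fun i => (f i).2.1
  have hlow := one_le_normSq_pow_mul_norm_det g hg K R
    (fun i => 4 * j * (f i).1.1 + p * (f i).1.2) (fun i => (f i).1.1) (fun i => (f i).1.2) hr hf
  have hup := norm_det_mul_exp_le p K R j δ ((S + 2) * p) hp.ne_zero (by positivity) hδ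
    (fun i => (f i).1.1) (fun i => (f i).1.2) hr (fun i => by exact_mod_cast (f i).2.2)
  rw [← hγ] at hup
  have hK' : (0 : ℝ) < K := by exact_mod_cast hK
  have hp0 : (0 : ℝ) < p := by exact_mod_cast hp.pos
  set D := ‖(Matrix.of fun i i' : Fin K × Fin 9 =>
      (binomialPoly i.1).eval ((4 * j * (f i').1.1 + p * (f i').1.2 : ℤ) : ℂ) *
      ((starRingEnd ℂ (g : ℂ) / g) ^ (f i').1.1 * Complex.I ^ (f i').1.2) ^
        ((i.2 : ℤ) - 4)).det‖ with hD
  have hD0 : 0 < D := norm_pos_iff.mpr hf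
  have hn0 : 0 < Complex.normSq (g : ℂ) := Complex.normSq_pos.mpr h0
  have hlow' := Real.log_le_log one_pos hlow
  rw [Real.log_one, Real.log_mul (by positivity) hD0.ne', Real.log_pow] at hlow'
  have hup' := Real.log_le_log (by positivity) hup
  have ht : (0 : ℝ) ≤ Real.exp 2 * ((S + 2) * p) := by positivity
  rw [Real.log_mul hD0.ne' (by positivity), Real.log_pow, Real.log_exp,
    Real.log_mul (by positivity) (Finset.prod_pos fun i _ => by positivity).ne'] at hup'
  have hprod := log_prod_le p K hp.ne_zero hK _ ht
  have hfac : Real.log ((9 * K).factorial : ℕ) ≤ 9 * K * Real.log (9 * K) := by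
    have h2 : (((9 * K).factorial : ℕ) : ℝ) ≤ (9 * K : ℝ) ^ (9 * K) := by
      exact_mod_cast Nat.factorial_le_pow (9 * K)
    refine (Real.log_le_log (by positivity) h2).trans_eq ?_
    rw [Real.log_pow]
    push_cast
    rfl
  have hhalf : ((9 * K * (9 * K - 1) / 2 : ℕ) : ℝ) * 2 = 9 * K * (9 * K - 1) := by
    have h3 : 9 * K * (9 * K - 1) / 2 * 2 = 9 * K * (9 * K - 1) :=
      Nat.div_mul_cancel (even_iff_two_dvd.mp (Nat.even_mul_pred_self (9 * K)))
    have h4 : ((9 * K - 1 : ℕ) : ℝ) = 9 * K - 1 := by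
      rw [Nat.cast_sub (by omega)]; push_cast; rfl
    rw [← h4]
    exact_mod_cast h3
  have hpt : 10 / 9 * (Real.pi / p) * (Real.exp 2 * ((S + 2) * p)) =
      10 / 9 * Real.pi * (Real.exp 2 * (S + 2)) := by
    field_simp
  rw [hpt] at hprod
  have hfin : 9 * K * (9 * K - 1 : ℝ) ≤ 9 * K * (20 / 9 * R * Real.log (Complex.normSq (g : ℂ)) +
      Real.log (9 * K) + Real.log 2 + K / 2 +
      (K - 1) / 2 * Real.log (2 * (Real.exp 2 * ((S + 2) * p)) / K + 2) +
      10 / 9 * Real.pi * (Real.exp 2 * (S + 2))) := by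
    push_cast at hlow'
    linarith
  exact le_of_mul_le_mul_left hfin (by positivity)

theorem exp_two_lt : Real.exp 2 < 7.39 := by
  have h := Real.exp_one_lt_d9
  have h0 := Real.exp_pos 1
  rw [show (2 : ℝ) = 1 + 1 by norm_num, Real.exp_add]
  nlinarith

theorem interpolation_numeric (p K R S : ℕ) (Y : ℝ) (hY : 2.77 ≤ Y) (hp : 2000 ≤ p)
    (hK1 : (p - 1) * Y / 36 - 1 < K) (hS : (S : ℝ) ≤ 2 * Y + 1)
    (hR : (R : ℝ) ≤ (p + 47) / 32) :
    20 / 9 * R * Y + Real.log (9 * K) +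
      Real.log 2 + K / 2 + (K - 1) / 2 * Real.log (2 * (Real.exp 2 * ((S + 2) * p)) / K + 2) +
      10 / 9 * Real.pi * (Real.exp 2 * (S + 2)) < (9 * K - 1 : ℝ) := by
  have hp' : (2000 : ℝ) ≤ p := by exact_mod_cast hp
  set P : ℝ := (p - 1) * Y / 36 with hP
  have hPY : 55.5 * Y ≤ P := by rw [hP]; nlinarith
  have hPp : p * Y ≤ 36.02 * P := by rw [hP]; nlinarith
  have hKP : 0.993 * P ≤ K := by linarith
  have hK0 : (0 : ℝ) < K := by linarith
  have hlog2 := Real.log_two_lt_d9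
  have hlog2' := Real.log_two_gt_d9
  have hexp := exp_two_lt
  have hexp0 := Real.exp_pos 2
  have hpi := Real.pi_lt_d2
  have hpi0 := Real.pi_pos
  have h1 : 20 / 9 * R * Y ≤ 2.6 * P := by
    have : 20 / 9 * R * Y ≤ 20 / 9 * ((p + 47) / 32) * Y := by gcongr
    nlinarith
  have h2 : Real.log (9 * K) ≤ K / 32 + 9 * Real.log 2 - 1 := by
    have h3 := Real.log_le_sub_one_of_pos (show (0 : ℝ) < K / 32 by positivity)
    have h4 : Real.log (9 * K) = Real.log 288 + Real.log (K / 32) := by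
      rw [← Real.log_mul (by norm_num) (by positivity)]; congr 1; ring
    have h5 : Real.log 288 ≤ 9 * Real.log 2 := by
      rw [show 9 * Real.log 2 = Real.log (2 ^ 9) by rw [Real.log_pow]; norm_num]
      exact Real.log_le_log (by norm_num) (by norm_num)
    linarith
  have h3 : Real.log (2 * (Real.exp 2 * ((S + 2) * p)) / K + 2) ≤ 11 * Real.log 2 := by
    rw [show 11 * Real.log 2 = Real.log (2 ^ 11) by rw [Real.log_pow]; norm_num]
    refine Real.log_le_log (by positivity) ?_
    have h4 : ((S : ℝ) + 2) * p ≤ 112 * K := by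
      have h5 : ((S : ℝ) + 2) * p ≤ (2 * Y + 3) * p := mul_le_mul_of_nonneg_right (by linarith) (by linarith)
      have h6 : 2.77 * p ≤ p * Y := by nlinarith
      nlinarith
    have h7 : Real.exp 2 * ((S + 2) * p) ≤ 7.39 * (112 * K) := by gcongr
    have h8 : 2 * (Real.exp 2 * ((S + 2) * p)) / K ≤ 2000 := by
      rw [div_le_iff₀ hK0]; linarith
    linarith
  have h4 : (K - 1) / 2 * Real.log (2 * (Real.exp 2 * ((S + 2) * p)) / K + 2) ≤
      (K - 1) / 2 * 7.63 := by
    refine mul_le_mul_of_nonneg_left (by linarith) (by linarith)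
  have h5 : 10 / 9 * Real.pi * (Real.exp 2 * (S + 2)) ≤ 26 * (2 * Y + 3) := by
    have h6 : Real.pi * Real.exp 2 ≤ 3.15 * 7.39 := by gcongr
    have h7 : Real.pi * Real.exp 2 * (S + 2) ≤ 3.15 * 7.39 * (2 * Y + 3) := by
      exact mul_le_mul h6 (by linarith) (by positivity) (by norm_num)
    nlinarith
  linarith

theorem isCoprime_star_of_isCoprime (g : GaussianInt) (h : IsCoprime g.re g.im)
    (hodd : Odd g.norm) : IsCoprime g (star g) := by
  obtain ⟨u, v, huv⟩ := h
  obtain ⟨k, hk⟩ := hodd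
  have hnorm : (g.norm : GaussianInt) = g * star g := Zsqrtd.norm_eq_mul_conj g
  have h1 : g + star g = 2 * (g.re : GaussianInt) := by
    ext <;> (simp; try ring)
  have h2 : g - star g = 2 * (g.im : GaussianInt) * ⟨0, 1⟩ := by
    ext <;> (simp; try ring)
  have h3 : (u : GaussianInt) * g.re + v * g.im = 1 := by exact_mod_cast huv
  have h4 : (⟨0, 1⟩ : GaussianInt) * ⟨0, 1⟩ = -1 := by ext <;> simp
  refine ⟨-(k : GaussianInt) * (u - v * ⟨0, 1⟩) + star g,
    -(k : GaussianInt) * (u + v * ⟨0, 1⟩), ?_⟩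
  have h5 : (u - v * ⟨0, 1⟩) * g + (u + v * ⟨0, 1⟩) * star g = (2 : GaussianInt) := by
    linear_combination (u : GaussianInt) * h1 - v * ⟨0, 1⟩ * h2 - 2 * v * g.im * h4 + 2 * h3
  have h6 : (g.norm : GaussianInt) = 2 * k + 1 := by rw [hk]; push_cast; rfl
  linear_combination -(k : GaussianInt) * h5 + h6 - hnorm

theorem zpow_eq_zero_of_conj_div_zpow_mul_I_zpow_eq_one (g : GaussianInt)
    (h : IsCoprime g.re g.im) (hodd : Odd g.norm) (hone : g.norm ≠ 1) (r s : ℤ)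
    (hrs : (starRingEnd ℂ (g : ℂ) / g) ^ r * Complex.I ^ s = 1) : r = 0 := by
  have hg : g ≠ 0 := by rintro rfl; simp at hodd
  have h0 : (g : ℂ) ≠ 0 := by simpa using hg
  have h1 : starRingEnd ℂ (g : ℂ) ≠ 0 := by simpa using hg
  have key : ∀ (n : ℕ) (s : ℤ), n ≠ 0 →
      (starRingEnd ℂ (g : ℂ) / g) ^ n * Complex.I ^ s ≠ 1 := by
    intro n s hn hns
    obtain ⟨z, hz⟩ := I_zpow_mem_range_toComplex s
    rw [← hz, div_pow, div_mul_eq_mul_div, div_eq_one_iff_eq (pow_ne_zero _ h0),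
      ← GaussianInt.toComplex_star, ← map_pow, ← map_pow, ← map_mul, GaussianInt.toComplex_inj] at hns
    have hdvd : g ∣ star g ^ n * z := by rw [hns]; exact dvd_pow_self g hn
    have hz1 : IsUnit z := by
      rw [← Zsqrtd.norm_eq_one_iff]
      have h2 : Complex.normSq (z : ℂ) = 1 := by
        rw [hz, Complex.normSq_eq_norm_sq]; simp
      rw [← GaussianInt.intCast_real_norm] at h2
      have h3 : z.norm = 1 := by exact_mod_cast h2
      rw [h3]; rfl
    have hu : IsUnit g := by
      have h5 := (isCoprime_star_of_isCoprime g h hodd).pow_right (n := n)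
      exact h5.isUnit_of_dvd' dvd_rfl ((hz1.dvd_mul_right).mp hdvd)
    rw [← Zsqrtd.norm_eq_one_iff] at hu
    have := GaussianInt.norm_nonneg g
    omega
  by_contra hr
  rcases lt_or_gt_of_ne hr with hlt | hgt
  · refine key r.natAbs (-s) (by omega) ?_
    rw [← zpow_natCast, Int.ofNat_natAbs_of_nonpos hlt.le, zpow_neg, zpow_neg, ← mul_inv, hrs,
      inv_one]
  · refine key r.natAbs s (by omega) ?_
    rw [← zpow_natCast, Int.natAbs_of_nonneg hgt.le, hrs]

theorem norm_conj_div_pow_sub_one (z : ℂ) (hz : z ≠ 0) (n : ℕ) :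
    ‖(starRingEnd ℂ z / z) ^ n - 1‖ = 2 * |(z ^ n).im| / ‖z‖ ^ n := by
  rw [div_pow, div_sub_one (pow_ne_zero _ hz), norm_div, norm_pow, ← map_pow, ← norm_neg, neg_sub,
    Complex.sub_conj, norm_mul, Complex.norm_I, mul_one, Complex.norm_real, Real.norm_eq_abs,
    abs_mul, abs_two]

/-- A unit complex number whose `p`-th power is close to `1` is close to a `p`-th root of unity. -/
theorem exists_int_eq_exp_of_norm_eq_one (γ : ℂ) (hγ : ‖γ‖ = 1) (p : ℕ) (hp : 0 < p) :
    ∃ (j : ℤ) (δ : ℝ), 2 * |j| ≤ p + 1 ∧ γ = Complex.exp ((2 * Real.pi * j / p + δ : ℝ) * Complex.I) ∧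
      |δ| ≤ Real.pi / 2 * ‖γ ^ p - 1‖ / p := by
  set θ := Complex.arg γ with hθ
  have hp0 : (0 : ℝ) < p := by exact_mod_cast hp
  have hpi := Real.pi_pos
  have h1 : γ = Complex.exp (θ * Complex.I) := by
    have := Complex.norm_mul_exp_arg_mul_I γ
    rw [hγ] at this
    simpa using this.symm
  set j := round (p * θ / (2 * Real.pi)) with hj
  have hjr := abs_sub_round (p * θ / (2 * Real.pi))
  rw [← hj] at hjr
  set x := p * θ - 2 * Real.pi * j with hx
  have hxj : p * θ / (2 * Real.pi) - j = x / (2 * Real.pi) := by rw [hx]; field_simp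
  have hxpi : |x| ≤ Real.pi := by
    rw [hxj, abs_div, abs_of_pos (show 0 < 2 * Real.pi by positivity), div_le_iff₀ (by positivity)]
      at hjr
    linarith
  refine ⟨j, x / p, ?_, ?_, ?_⟩
  · have h2 : |p * θ / (2 * Real.pi)| ≤ p / 2 := by
      rw [abs_div, abs_mul, abs_of_pos (show 0 < 2 * Real.pi by positivity), Nat.abs_cast,
        div_le_iff₀ (by positivity)]
      have := Complex.abs_arg_le_pi γ
      calc p * |θ| ≤ p * Real.pi := by gcongr
        _ = _ := by ring
    have h3 : |(j : ℝ)| ≤ p / 2 + 1 / 2 := by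
      have : (j : ℝ) = p * θ / (2 * Real.pi) - (p * θ / (2 * Real.pi) - j) := by ring
      rw [this]
      exact (abs_sub _ _).trans (add_le_add h2 hjr)
    have h4 : 2 * |(j : ℝ)| ≤ p + 1 := by linarith
    exact_mod_cast h4
  · conv_lhs => rw [h1]
    congr 3
    rw [hx]
    field_simp
    ring
  · have h5 : γ ^ p = Complex.exp (Complex.I * x) := by
      rw [h1, ← Complex.exp_nat_mul, Complex.exp_eq_exp_iff_exists_int]
      refine ⟨j, ?_⟩
      rw [hx]; push_cast; ring
    rw [h5, Complex.norm_exp_I_mul_ofReal_sub_one, abs_div, abs_of_pos hp0]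
    gcongr
    rw [Real.norm_eq_abs, abs_mul, abs_two]
    have h6 : |Real.sin (x / 2)| = Real.sin |x / 2| := by
      rw [Real.abs_sin_eq_sin_abs_of_abs_le_pi]
      rw [abs_div, abs_two]; linarith [abs_nonneg x]
    have h7 : 2 / Real.pi * |x / 2| ≤ Real.sin |x / 2| :=
      Real.mul_le_sin (abs_nonneg _) (by rw [abs_div, abs_two]; linarith)
    rw [h6]
    rw [abs_div, abs_two] at h7 ⊢
    calc |x| = Real.pi / 2 * (2 * (2 / Real.pi * (|x| / 2))) := by field_simp
      _ ≤ _ := by gcongr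

theorem abs_im_pow_ne_abs_im_of_large_prime (g : GaussianInt) (h : IsCoprime g.re g.im)
    (hodd : Odd g.norm) (h16 : 16 ≤ g.norm) (him : g.im ≠ 0) (p : ℕ) (hp : p.Prime)
    (hp2 : 2000 ≤ p) : |(g ^ p).im| ≠ |g.im| := by
  intro habs
  have hg : g ≠ 0 := by rintro rfl; simp at hodd
  have h0 : (g : ℂ) ≠ 0 := by simpa using hg
  have hpR : (2000 : ℝ) ≤ p := by exact_mod_cast hp2
  set γ : ℂ := starRingEnd ℂ (g : ℂ) / g with hγ
  have hγ1 : ‖γ‖ = 1 := by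
    rw [hγ, norm_div, RCLike.norm_conj, div_self (norm_ne_zero_iff.mpr h0)]
  set Y := Real.log (Complex.normSq (g : ℂ)) with hY
  have hn16 : (16 : ℝ) ≤ Complex.normSq (g : ℂ) := by
    rw [← GaussianInt.intCast_real_norm]; exact_mod_cast h16
  have hYexp : ‖(g : ℂ)‖ = Real.exp (Y / 2) := by
    have h1 : Real.exp (Y / 2) ^ 2 = ‖(g : ℂ)‖ ^ 2 := by
      rw [← Complex.normSq_eq_norm_sq, ← Real.exp_nat_mul]
      push_cast
      rw [mul_div_cancel₀ _ (two_ne_zero), hY, Real.exp_log (by linarith)]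
    exact ((sq_eq_sq₀ (Real.exp_pos _).le (norm_nonneg _)).mp h1).symm
  have hY277 : 2.77 ≤ Y := by
    have h1 : 4 * Real.log 2 ≤ Y := by
      rw [show 4 * Real.log 2 = Real.log (2 ^ 4) by rw [Real.log_pow]; norm_num, hY]
      exact Real.log_le_log (by norm_num) (by linarith)
    linarith [Real.log_two_gt_d9]
  have hb : ∀ n : ℕ, (((g : ℂ) ^ n).im) = ((g ^ n).im : ℤ) := by
    intro n; rw [← map_pow, GaussianInt.intCast_im]
  have hbg : (1 : ℝ) ≤ |(g.im : ℝ)| := by exact_mod_cast Int.one_le_abs him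
  have hbg' : |(g.im : ℝ)| ≤ Real.exp (Y / 2) := by
    have := Complex.abs_im_le_norm (g : ℂ)
    rwa [← GaussianInt.intCast_im, hYexp] at this
  have hup : ‖γ ^ p - 1‖ ≤ 2 * Real.exp (-((p - 1) * Y / 2)) := by
    rw [hγ, norm_conj_div_pow_sub_one _ h0, hb, hYexp, ← Real.exp_nat_mul]
    have h1 : |(((g ^ p).im : ℤ) : ℝ)| ≤ Real.exp (Y / 2) := by
      refine le_trans (le_of_eq ?_) hbg'
      exact_mod_cast habs
    rw [div_le_iff₀ (Real.exp_pos _), mul_assoc, ← Real.exp_add]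
    have h2 : -((p - 1) * Y / 2) + p * (Y / 2) = Y / 2 := by ring
    rw [h2]
    linarith
  have hlow : 2 * Real.exp (-(Y / 2)) ≤ ‖γ - 1‖ := by
    have h1 := norm_conj_div_pow_sub_one _ h0 1
    rw [pow_one, pow_one, pow_one] at h1
    rw [hγ, h1, ← GaussianInt.intCast_im, hYexp, le_div_iff₀ (Real.exp_pos _), mul_assoc,
      ← Real.exp_add]
    simpa using hbg
  obtain ⟨j, δ, hj, hγδ, hδ⟩ := exists_int_eq_exp_of_norm_eq_one γ hγ1 p hp.pos
  have hpi := Real.pi_lt_d2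
  have hpi0 := Real.pi_pos
  have hδ' : |δ| ≤ Real.pi / p * Real.exp (-((p - 1) * Y / 2)) := by
    refine hδ.trans ?_
    calc Real.pi / 2 * ‖γ ^ p - 1‖ / p
        ≤ Real.pi / 2 * (2 * Real.exp (-((p - 1) * Y / 2))) / p := by gcongr
      _ = _ := by ring
  have hjp : ¬ (p : ℤ) ∣ j := by
    intro hdvd
    have hj0 : j = 0 := Int.eq_zero_of_abs_lt_dvd hdvd (by omega)
    rw [hj0] at hγδ
    have h1 : ‖γ - 1‖ ≤ |δ| := by
      rw [hγδ, mul_comm]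
      refine Real.norm_exp_I_mul_ofReal_sub_one_le.trans_eq ?_
      simp
    have h2 : Real.pi / p ≤ 1 := by rw [div_le_one (by linarith)]; linarith
    have h3 : Real.exp (-((p - 1) * Y / 2)) ≤ Real.exp (-(Y / 2)) :=
      Real.exp_le_exp.mpr (by nlinarith)
    have h4 : Real.pi / p * Real.exp (-((p - 1) * Y / 2)) ≤ 1 * Real.exp (-(Y / 2)) := by gcongr
    linarith [Real.exp_pos (-(Y / 2))]
  set P : ℝ := (p - 1) * Y / 36 with hP
  have hP1 : 100 ≤ P := by rw [hP]; nlinarith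
  set K := ⌊P⌋₊ with hK
  set S := ⌈2 * Y⌉₊ with hS
  set R := (p + 47) / 32 with hR
  have hKle : (K : ℝ) ≤ P := Nat.floor_le (by linarith)
  have hKgt : P - 1 < K := by linarith [Nat.lt_floor_add_one P]
  have hSge : 2 * Y ≤ S := Nat.le_ceil _
  have hSle : (S : ℝ) ≤ 2 * Y + 1 := (Nat.ceil_lt_add_one (by linarith)).le
  have hR1 : (R : ℝ) ≤ (p + 47) / 32 := by
    have : 32 * R ≤ p + 47 := by omega
    have : (32 * R : ℝ) ≤ p + 47 := by exact_mod_cast this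
    linarith
  have hR2 : (p + 16 : ℝ) ≤ 32 * R := by
    have : p + 16 ≤ 32 * R := by omega
    exact_mod_cast this
  have hK1 : 1 ≤ K := by
    have : (1 : ℝ) ≤ K := by linarith
    exact_mod_cast this
  have hcount : 9 * (K - 1) < (2 * R - 1) * (2 * S) := by
    have h1 : 9 * K ≤ (2 * R - 1) * (2 * S) := by
      have h2 : ((2 * R - 1 : ℕ) : ℝ) = 2 * R - 1 := by
        rw [Nat.cast_sub (by omega)]; push_cast; rfl
      have h3 : (9 * K : ℝ) ≤ (2 * R - 1) * (2 * S) := by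
        calc (9 * K : ℝ) ≤ 9 * P := by linarith
          _ = (p - 1) / 16 * (2 * (2 * Y)) := by rw [hP]; ring
          _ ≤ (2 * R - 1) * (2 * S) := by
            refine mul_le_mul (by linarith) (by linarith) (by linarith) (by linarith)
      rw [← h2] at h3
      exact_mod_cast h3
    omega
  have hδ4 : 4 * R * |δ| ≤ Real.exp (-(2 * (9 * K))) / 2 := by
    have h1 : Real.exp (-((p - 1) * Y / 2)) ≤ Real.exp (-(2 * (9 * K))) :=
      Real.exp_le_exp.mpr (by rw [hP] at hKle; linarith)
    calc 4 * R * |δ| ≤ 4 * ((p + 47) / 32) * (3.15 / p * Real.exp (-(2 * (9 * K)))) := by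
          gcongr
          exact hδ'.trans (by gcongr)
      _ = ((p + 47) * 3.15 / (8 * p)) * Real.exp (-(2 * (9 * K))) := by
          field_simp
          ring
      _ ≤ 1 / 2 * Real.exp (-(2 * (9 * K))) := by
          refine mul_le_mul_of_nonneg_right ?_ (Real.exp_pos _).le
          rw [div_le_iff₀ (by linarith)]
          linarith
      _ = _ := by ring
  have hineq := interpolation_inequality g hg p K R S j δ hp (by omega) hjp hγδ
    (zpow_eq_zero_of_conj_div_zpow_mul_I_zpow_eq_one g h hodd (by omega))
    hK1 (by omega) (by omega) hcount hδ4
  exact absurd hineq (not_le.mpr (interpolation_numeric p K R S Y hY277 hp2 hKgt hSle hR1))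

section SubsetSum

variable {p : ℕ} [Fact p.Prime] {R : Type*} [CommRing R]

/-- The coefficient of the group element `s` in `∏ j ∈ Q, (α - β * [j])`. -/
def subsetSumCoeff (Q : Finset (ZMod p)) (α β : R) (s : ZMod p) : R :=
  ∑ A ∈ Q.powerset with ∑ a ∈ A, a = s, (-β) ^ #A * α ^ (#Q - #A)

theorem addChar_sum (A : Finset (ZMod p)) (ψ : AddChar (ZMod p) R) :
    ψ (∑ a ∈ A, a) = ∏ a ∈ A, ψ a := by
  induction A using Finset.induction_on with
  | empty => simp
  | insert a A ha ih => rw [sum_insert ha, prod_insert ha, AddChar.map_add_eq_mul, ih]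

theorem prod_sub_mul_addChar_eq_sum (Q : Finset (ZMod p)) (α β : R) (ψ : AddChar (ZMod p) R) :
    ∏ j ∈ Q, (α - β * ψ j) = ∑ s, subsetSumCoeff Q α β s * ψ s := by
  have h1 : ∀ j, α - β * ψ j = -β * ψ j + α := fun j => by ring
  simp only [h1, prod_add, subsetSumCoeff, sum_mul]
  rw [← sum_fiberwise Q.powerset (fun A => ∑ a ∈ A, a)]
  refine sum_congr rfl fun s _ => sum_congr rfl fun A hA => ?_
  obtain ⟨hA, hs⟩ := mem_filter.mp hA
  rw [prod_mul_distrib, prod_const, prod_const, card_sdiff_of_subset (mem_powerset.mp hA), ← hs,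
    addChar_sum]
  ring

theorem map_subsetSumCoeff {S : Type*} [CommRing S] (φ : R →+* S) (Q : Finset (ZMod p)) (α β : R)
    (s : ZMod p) : φ (subsetSumCoeff Q α β s) = subsetSumCoeff Q (φ α) (φ β) s := by
  simp [subsetSumCoeff]

theorem subsetSumCoeff_mul (Q : Finset (ZMod p)) (α β : R) (u : ZMod p) (hu : u ≠ 0)
    (hQ : Q.image (u * ·) = Q) (s : ZMod p) :
    subsetSumCoeff Q α β (u * s) = subsetSumCoeff Q α β s := by
  have hinj : Function.Injective (u * · : ZMod p → ZMod p) := mul_right_injective₀ hu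
  symm
  refine sum_bij (fun A _ => A.image (u * ·)) ?_ ?_ ?_ ?_
  · intro A hA
    obtain ⟨hA, hs⟩ := mem_filter.mp hA
    refine mem_filter.mpr ⟨mem_powerset.mpr ?_, ?_⟩
    · exact (image_subset_image (mem_powerset.mp hA)).trans hQ.subset
    · rw [sum_image hinj.injOn, ← mul_sum, hs]
  · intro A _ B _ h
    exact image_injective hinj h
  · intro B hB
    obtain ⟨hB, hs⟩ := mem_filter.mp hB
    rw [mem_powerset, ← hQ] at hB
    obtain ⟨A, hA, rfl⟩ := subset_image_iff.mp hB
    refine ⟨A, mem_filter.mpr ⟨mem_powerset.mpr hA, ?_⟩, rfl⟩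
    rw [sum_image hinj.injOn, ← mul_sum] at hs
    exact mul_left_cancel₀ hu hs
  · intro A _
    rw [card_image_of_injective _ hinj]

theorem subsetSumCoeff_swap (Q : Finset (ZMod p)) (α β : R) (hsum : ∑ a ∈ Q, a = 0)
    (hodd : Odd #Q) (s : ZMod p) : subsetSumCoeff Q β α s = -subsetSumCoeff Q α β (-s) := by
  have hcompl : ∀ A ∈ Q.powerset, ∑ a ∈ Q \ A, a = -∑ a ∈ A, a := by
    intro A hA
    have := sum_sdiff (mem_powerset.mp hA) (f := fun a : ZMod p => a)
    rw [hsum] at this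
    exact eq_neg_of_add_eq_zero_left this
  rw [subsetSumCoeff, subsetSumCoeff, ← sum_neg_distrib]
  refine sum_bij' (fun A _ => Q \ A) (fun A _ => Q \ A) ?_ ?_ ?_ ?_ ?_
  · intro A hA
    obtain ⟨hA, hs⟩ := mem_filter.mp hA
    exact mem_filter.mpr ⟨mem_powerset.mpr sdiff_subset, by rw [hcompl A hA, hs]⟩
  · intro A hA
    obtain ⟨hA, hs⟩ := mem_filter.mp hA
    exact mem_filter.mpr ⟨mem_powerset.mpr sdiff_subset, by rw [hcompl A hA, hs, neg_neg]⟩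
  · intro A hA
    exact Finset.sdiff_sdiff_eq_self (mem_powerset.mp (mem_filter.mp hA).1)
  · intro A hA
    exact Finset.sdiff_sdiff_eq_self (mem_powerset.mp (mem_filter.mp hA).1)
  · intro A hA
    have hA := mem_powerset.mp (mem_filter.mp hA).1
    have hle := card_le_card hA
    rw [card_sdiff_of_subset hA, Nat.sub_sub_self hle]
    obtain ⟨n, hn⟩ := Nat.exists_eq_add_of_le hle
    rw [hn, Nat.add_sub_cancel_left]
    rw [hn] at hodd
    rw [neg_pow α, neg_pow β]
    have : (-1 : R) ^ #A = - (-1) ^ n := by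
      rcases Nat.even_or_odd n with h | h
      · rw [h.neg_one_pow, (show Odd #A from (Nat.odd_add.mp hodd).mpr h).neg_one_pow]
      · rw [h.neg_one_pow, neg_neg]
        refine Even.neg_one_pow ?_
        by_contra h'
        exact (Nat.not_even_iff_odd.mpr h) ((Nat.odd_add.mp hodd).mp (Nat.not_even_iff_odd.mp h'))
    rw [this]
    ring

end SubsetSum

section Residues

variable (p : ℕ) [Fact p.Prime]

/-- The set of nonzero squares modulo `p`. -/
def nonzeroSquares : Finset (ZMod p) := univ.filter fun a => quadraticChar (ZMod p) a = 1

variable {p}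

theorem mem_nonzeroSquares {a : ZMod p} :
    a ∈ nonzeroSquares p ↔ quadraticChar (ZMod p) a = 1 := by simp [nonzeroSquares]

theorem image_mul_nonzeroSquares (u : ZMod p) (hu : quadraticChar (ZMod p) u = 1) :
    (nonzeroSquares p).image (u * ·) = nonzeroSquares p := by
  have hu0 : u ≠ 0 := by rintro rfl; simp at hu
  ext a
  simp only [mem_image, mem_nonzeroSquares]
  constructor
  · rintro ⟨b, hb, rfl⟩
    rw [map_mul, hu, hb, one_mul]
  · intro ha
    have h1 : quadraticChar (ZMod p) (u * (u⁻¹ * a)) = 1 := by rwa [mul_inv_cancel_left₀ hu0]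
    rw [map_mul, hu, one_mul] at h1
    exact ⟨u⁻¹ * a, h1, mul_inv_cancel_left₀ hu0 a⟩

theorem quadraticChar_neg_eq_neg (hp : p % 4 = 3) (a : ZMod p) :
    quadraticChar (ZMod p) (-a) = -quadraticChar (ZMod p) a := by
  have h2 : ringChar (ZMod p) ≠ 2 := by rw [ZMod.ringChar_zmod_n]; omega
  have h : quadraticChar (ZMod p) (-1) = -1 := by
    rw [quadraticChar_neg_one h2, ZMod.card, ZMod.χ₄_nat_three_mod_four hp]
  rw [neg_eq_neg_one_mul, map_mul, h, neg_one_mul]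

theorem sum_nonzeroSquares (hp : 3 < p) : ∑ a ∈ nonzeroSquares p, a = 0 := by
  have hpr : p.Prime := Fact.out
  have h2 : (2 : ZMod p) ≠ 0 := by
    intro h
    have := (ZMod.natCast_eq_zero_iff 2 p).mp (by exact_mod_cast h)
    have := Nat.le_of_dvd (by norm_num) this
    omega
  have h3 : (3 : ZMod p) ≠ 0 := by
    intro h
    have := (ZMod.natCast_eq_zero_iff 3 p).mp (by exact_mod_cast h)
    have := Nat.le_of_dvd (by norm_num) this
    omega
  have h4 := image_mul_nonzeroSquares (p := p) (2 ^ 2) (quadraticChar_sq_one' h2)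
  have h4' : (2 ^ 2 : ZMod p) ≠ 0 := pow_ne_zero _ h2
  have h5 : ∑ a ∈ nonzeroSquares p, a = 2 ^ 2 * ∑ a ∈ nonzeroSquares p, a := by
    conv_lhs => rw [← h4]
    rw [sum_image (mul_right_injective₀ h4').injOn, mul_sum]
  have h6 : 3 * ∑ a ∈ nonzeroSquares p, a = 0 := by linear_combination -h5
  exact (mul_eq_zero.mp h6).resolve_left h3

theorem prod_nonzeroSquares_mul_prod_neg {M : Type*} [CommMonoid M] (hp : p % 4 = 3)
    (f : ZMod p → M) :
    (∏ a ∈ nonzeroSquares p, f a) * ∏ a ∈ nonzeroSquares p, f (-a) = ∏ a ∈ univ.erase 0, f a := by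
  rw [← prod_image (s := nonzeroSquares p) (g := fun a : ZMod p => -a) (f := f)
    neg_injective.injOn, ← prod_union]
  · refine prod_congr ?_ fun _ _ => rfl
    ext a
    simp only [mem_union, mem_image, mem_nonzeroSquares, mem_erase, mem_univ, and_true]
    constructor
    · rintro (h | ⟨b, hb, rfl⟩)
      · rintro rfl; simp at h
      · rw [neg_ne_zero]; rintro rfl; simp at hb
    · intro ha
      rcases quadraticChar_dichotomy ha with h | h
      · exact Or.inl h
      · exact Or.inr ⟨-a, by rw [quadraticChar_neg_eq_neg hp, h, neg_neg], neg_neg a⟩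
  · rw [Finset.disjoint_left]
    intro a ha hb'
    obtain ⟨b, hb, rfl⟩ := mem_image.mp hb'
    rw [mem_nonzeroSquares] at ha hb
    rw [quadraticChar_neg_eq_neg hp, hb] at ha
    norm_num at ha

theorem odd_card_nonzeroSquares (hp : p % 4 = 3) : Odd #(nonzeroSquares p) := by
  have h := prod_nonzeroSquares_mul_prod_neg hp (fun _ : ZMod p => Multiplicative.ofAdd 1)
  rw [prod_const, prod_const, card_erase_of_mem (mem_univ _), card_univ, ZMod.card,
    ← ofAdd_nsmul, ← ofAdd_nsmul, ← ofAdd_add] at h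
  have h' := Multiplicative.ofAdd.injective h
  simp only [smul_eq_mul, mul_one] at h'
  rw [Nat.odd_iff]
  omega

end Residues

section

variable {p : ℕ} [Fact p.Prime]

theorem two_mul_subsetSumCoeff {R : Type*} [CommRing R] (hp : p % 4 = 3) (α β : R) (s : ZMod p)
    (hs : s ≠ 0) : 2 * subsetSumCoeff (nonzeroSquares p) α β s =
      (subsetSumCoeff (nonzeroSquares p) α β 1 + subsetSumCoeff (nonzeroSquares p) α β (-1)) +
      (quadraticChar (ZMod p) s : ℤ) *
      (subsetSumCoeff (nonzeroSquares p) α β 1 - subsetSumCoeff (nonzeroSquares p) α β (-1)) := by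
  rcases quadraticChar_dichotomy hs with h | h
  · have h1 := subsetSumCoeff_mul (nonzeroSquares p) α β s hs (image_mul_nonzeroSquares s h) 1
    rw [mul_one] at h1
    rw [h, h1]; push_cast; ring
  · have h2 : quadraticChar (ZMod p) (-s) = 1 := by rw [quadraticChar_neg_eq_neg hp, h, neg_neg]
    have h1 := subsetSumCoeff_mul (nonzeroSquares p) α β (-s) (neg_ne_zero.mpr hs)
      (image_mul_nonzeroSquares (-s) h2) (-1)
    rw [neg_mul_neg, mul_one] at h1
    rw [h, h1]; push_cast; ring

theorem two_mul_prod_nonzeroSquares_sub {R : Type*} [CommRing R] [IsDomain R] (hp : p % 4 = 3)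
    (α β : R) (ψ : AddChar (ZMod p) R) (hψ : ψ ≠ 1) :
    2 * ∏ j ∈ nonzeroSquares p, (α - β * ψ j) =
      (2 * subsetSumCoeff (nonzeroSquares p) α β 0 - subsetSumCoeff (nonzeroSquares p) α β 1 -
        subsetSumCoeff (nonzeroSquares p) α β (-1)) +
      (subsetSumCoeff (nonzeroSquares p) α β 1 - subsetSumCoeff (nonzeroSquares p) α β (-1)) *
        gaussSum ((quadraticChar (ZMod p)).ringHomComp (Int.castRingHom R)) ψ := by
  set c := subsetSumCoeff (nonzeroSquares p) α β with hc
  have h0 := AddChar.sum_eq_zero_of_ne_one hψ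
  rw [prod_sub_mul_addChar_eq_sum, gaussSum, mul_sum]
  have h1 : ∀ s : ZMod p, 2 * (c s * ψ s) =
      (if s = 0 then 2 * c 0 - c 1 - c (-1) else 0) + (c 1 + c (-1)) * ψ s +
      (c 1 - c (-1)) * (((quadraticChar (ZMod p)).ringHomComp (Int.castRingHom R)) s * ψ s) := by
    intro s
    split_ifs with hs
    · subst hs; simp
    · have := two_mul_subsetSumCoeff hp α β s hs
      rw [← hc] at this
      rw [MulChar.ringHomComp_apply, eq_intCast, ← mul_assoc, this]
      ring
  rw [sum_congr rfl fun s _ => h1 s, sum_add_distrib, sum_add_distrib, ← mul_sum, ← mul_sum, h0,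
    sum_ite_eq' univ (0 : ZMod p)]
  simp

/-- The formula of Gauss for `4 (α ^ p - β ^ p) / (α - β)` when `p ≡ 3 mod 4`. -/
theorem gauss_formula (hp : p % 4 = 3) (α β U : ℂ) (hαβ : α ≠ β)
    (hU : α ^ p - β ^ p = (α - β) * U) :
    4 * U = (2 * subsetSumCoeff (nonzeroSquares p) α β 0 -
        subsetSumCoeff (nonzeroSquares p) α β 1 - subsetSumCoeff (nonzeroSquares p) α β (-1)) ^ 2 +
      p * (subsetSumCoeff (nonzeroSquares p) α β 1 -
        subsetSumCoeff (nonzeroSquares p) α β (-1)) ^ 2 := by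
  have hpr : p.Prime := Fact.out
  have hζ : IsPrimitiveRoot (Complex.exp (2 * Real.pi * Complex.I / p)) p :=
    Complex.isPrimitiveRoot_exp p hpr.ne_zero
  set ζ := Complex.exp (2 * Real.pi * Complex.I / p)
  set ψ : AddChar (ZMod p) ℂ := AddChar.zmodChar p hζ.pow_eq_one with hψ
  have hψp : ψ.IsPrimitive := AddChar.zmodChar_primitive_of_primitive_root p hζ
  have hψ1 : ψ ≠ 1 := by
    have := hψp (one_ne_zero)
    simpa using this
  have hψ2 : ψ⁻¹ ≠ 1 := inv_ne_one.mpr hψ1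
  set χ := (quadraticChar (ZMod p)).ringHomComp (Int.castRingHom ℂ) with hχ
  have h2 : ringChar (ZMod p) ≠ 2 := by rw [ZMod.ringChar_zmod_n]; omega
  have hχneg : χ (-1) = -1 := by
    rw [hχ, MulChar.ringHomComp_apply, quadraticChar_neg_eq_neg hp]; simp
  have hχ1 : χ ≠ 1 := by
    intro h
    rw [h, MulChar.one_apply (isUnit_one.neg)] at hχneg
    norm_num at hχneg
  have hχq : χ.IsQuadratic := (quadraticChar_isQuadratic (ZMod p)).comp _
  have hsq := gaussSum_sq hχ1 hχq hψp
  rw [hχneg, ZMod.card] at hsq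
  have hinv : gaussSum χ ψ⁻¹ = -gaussSum χ ψ := by
    simp only [gaussSum]
    rw [← Equiv.sum_comp (Equiv.neg (ZMod p)), ← sum_neg_distrib]
    refine sum_congr rfl fun s _ => ?_
    have h3 : χ (-s) = -χ s := by rw [neg_eq_neg_one_mul, map_mul, hχneg, neg_one_mul]
    simp [AddChar.inv_apply, h3]
  have hA := two_mul_prod_nonzeroSquares_sub hp α β ψ hψ1
  have hB := two_mul_prod_nonzeroSquares_sub hp α β ψ⁻¹ hψ2
  rw [← hχ] at hA hB
  rw [hinv] at hB
  have hprod : (∏ j ∈ nonzeroSquares p, (α - β * ψ j)) *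
      ∏ j ∈ nonzeroSquares p, (α - β * ψ⁻¹ j) = U := by
    have h4 := prod_nonzeroSquares_mul_prod_neg hp (fun j => α - β * ψ j)
    simp only [AddChar.inv_apply]
    rw [h4]
    have h5 : (α - β) * ∏ j ∈ univ.erase (0 : ZMod p), (α - β * ψ j) = (α - β) * U := by
      rw [← hU, hζ.pow_sub_pow_eq_prod_sub_mul α β hpr.pos]
      have h6 := mul_prod_erase univ (fun j : ZMod p => α - β * ψ j) (mem_univ 0)
      rw [AddChar.map_zero_eq_one, mul_one] at h6
      rw [h6]
      refine prod_bij (fun j _ => ψ j) ?_ ?_ ?_ ?_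
      · intro j _
        rw [Polynomial.mem_nthRootsFinset hpr.pos, hψ, AddChar.zmodChar_apply, ← pow_mul,
          mul_comm, pow_mul, hζ.pow_eq_one, one_pow]
      · intro j _ k _ h
        rw [hψ, AddChar.zmodChar_apply, AddChar.zmodChar_apply] at h
        exact ZMod.val_injective p (hζ.pow_inj (ZMod.val_lt _) (ZMod.val_lt _) h)
      · intro z hz
        rw [Polynomial.mem_nthRootsFinset hpr.pos] at hz
        obtain ⟨i, hi, rfl⟩ := hζ.eq_pow_of_pow_eq_one hz
        refine ⟨(i : ZMod p), mem_univ _, ?_⟩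
        rw [hψ, AddChar.zmodChar_apply, ZMod.val_cast_of_lt hi]
      · intro j _; ring
    exact mul_left_cancel₀ (sub_ne_zero.mpr hαβ) h5
  set c := subsetSumCoeff (nonzeroSquares p) α β
  linear_combination (-4) * hprod + 2 * (∏ j ∈ nonzeroSquares p, (α - β * ψ⁻¹ j)) * hA +
    ((2 * c 0 - c 1 - c (-1)) + (c 1 - c (-1)) * gaussSum χ ψ) * hB - (c 1 - c (-1)) ^ 2 * hsq

end

theorem exists_pell_of_im_pow_eq_neg_im (p : ℕ) (hpr : p.Prime) (hp : p % 4 = 3) (hp3 : 3 < p)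
    (g : GaussianInt) (him : g.im ≠ 0) (h : (g ^ p).im = -g.im) :
    ∃ c G : ℤ, (g.im * c) ^ 2 - p * G ^ 2 = 1 := by
  have : Fact p.Prime := ⟨hpr⟩
  set c := subsetSumCoeff (nonzeroSquares p) g (star g) with hc
  set A := 2 * c 0 - c 1 - c (-1) with hA
  set B := c 1 - c (-1) with hB
  have hsum := sum_nonzeroSquares (p := p) hp3
  have hodd := odd_card_nonzeroSquares hp
  have hstar : ∀ s, star (c s) = -c (-s) := by
    intro s
    have h1 := map_subsetSumCoeff (starRingEnd GaussianInt) (nonzeroSquares p) g (star g) s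
    rw [starRingEnd_apply, starRingEnd_apply, starRingEnd_apply, star_star] at h1
    exact h1.trans (subsetSumCoeff_swap _ _ _ hsum hodd s)
  have hstarA : star A = -A := by
    rw [hA]
    simp only [star_sub, star_mul, hstar, neg_zero, neg_neg, star_ofNat]
    ring
  have hstarB : star B = B := by
    rw [hB]
    simp only [star_sub, hstar, neg_neg]
    ring
  have hdvd : g - star g ∣ A := by
    rw [← Ideal.mem_span_singleton, ← Ideal.Quotient.eq_zero_iff_mem]
    set φ := Ideal.Quotient.mk (Ideal.span {g - star g}) with hφ
    have h1 : φ g = φ (star g) := by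
      rw [← sub_eq_zero, ← map_sub, Ideal.Quotient.eq_zero_iff_mem]
      exact Ideal.mem_span_singleton_self _
    have h2 : ∀ s, φ (c s) = -φ (c (-s)) := by
      intro s
      rw [map_subsetSumCoeff, map_subsetSumCoeff, ← h1]
      exact subsetSumCoeff_swap _ _ _ hsum hodd s
    have h3 := h2 0
    have h4 := h2 1
    rw [neg_zero] at h3
    rw [hA, map_sub, map_sub, map_mul, map_ofNat]
    linear_combination h3 - h4
  have hsub : g - star g = ⟨0, 2 * g.im⟩ := by
    ext
    · simp
    · simp; ring
  have hpow : g ^ p - star g ^ p = (g - star g) * (-1) := by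
    rw [← star_pow]
    ext
    · simp only [Zsqrtd.re_sub, Zsqrtd.re_star, sub_self, hsub]
      simp
    · simp only [Zsqrtd.im_sub, Zsqrtd.im_star, hsub, h]
      simp
      ring
  have hne : (g : ℂ) ≠ ((star g : GaussianInt) : ℂ) := by
    intro heq
    rw [GaussianInt.toComplex_inj] at heq
    have := congrArg Zsqrtd.im heq
    simp only [Zsqrtd.im_star] at this
    omega
  have key := gauss_formula hp (g : ℂ) ((star g : GaussianInt) : ℂ) (-1) hne (by
    rw [← map_pow, ← map_pow, ← map_sub, hpow, map_mul, map_sub]; simp)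
  have hform : (-4 : GaussianInt) = A ^ 2 + p * B ^ 2 := by
    rw [← GaussianInt.toComplex_inj]
    simp only [← map_subsetSumCoeff] at key
    simp only [hA, hB, map_add, map_sub, map_mul, map_pow, map_neg, map_ofNat, map_natCast]
    rw [← key]
    ring
  obtain ⟨w, hw⟩ := hdvd
  have hAre : A.re = 0 := by
    have := congrArg Zsqrtd.re hstarA
    simp only [Zsqrtd.re_star, Zsqrtd.re_neg] at this
    omega
  have hBim : B.im = 0 := by
    have := congrArg Zsqrtd.im hstarB
    simp only [Zsqrtd.im_star] at this
    omega
  have hAim : A.im = 2 * (g.im * w.re) := by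
    rw [hw, hsub]; simp; ring
  have hre := congrArg Zsqrtd.re hform
  simp [pow_two, hAre, hBim, hAim] at hre
  have hev : Even B.re := by
    have h5 : (p : ℤ) * (B.re * B.re) = 4 * ((g.im * w.re) * (g.im * w.re)) - 4 := by linarith
    have h6 : Even ((p : ℤ) * (B.re * B.re)) := by
      rw [h5]; exact ⟨2 * ((g.im * w.re) * (g.im * w.re)) - 2, by ring⟩
    have h7 : ¬ Even (p : ℤ) := by rw [Int.even_iff]; omega
    simpa [Int.even_mul, h7] using h6
  obtain ⟨G, hG⟩ := hev
  refine ⟨w.re, G, ?_⟩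
  rw [hG] at hre
  linarith

namespace Pell.Solution₁

theorem odd_x_and_exists_of_pow {d : ℤ} (a : Solution₁ d) (n : ℕ) :
    Odd (a ^ (2 * n)).x ∧ ∃ c, Odd c ∧ (a ^ (2 * n + 1)).x = a.x * c := by
  have hrec : ∀ k : ℕ, (a ^ (k + 2)).x = 2 * a.x * (a ^ (k + 1)).x - (a ^ k).x := by
    intro k
    have h1 : (a ^ (k + 1)).y = (a ^ k).x * a.y + (a ^ k).y * a.x := by rw [pow_succ, y_mul]
    have h2 : (a ^ (k + 1)).x = (a ^ k).x * a.x + d * ((a ^ k).y * a.y) := by rw [pow_succ, x_mul]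
    rw [pow_succ, x_mul, h1, h2]
    linear_combination (-(a ^ k).x) * a.prop
  induction n with
  | zero => exact ⟨by simp, 1, odd_one, by simp⟩
  | succ n ih =>
    obtain ⟨h1, c, hc, h2⟩ := ih
    have h3 : Odd (a ^ (2 * (n + 1))).x := by
      rw [show 2 * (n + 1) = 2 * n + 2 by ring, hrec, mul_assoc]
      exact (even_two_mul _).sub_odd h1
    refine ⟨h3, 2 * (a ^ (2 * (n + 1))).x - c, (even_two_mul _).sub_odd hc, ?_⟩
    rw [show 2 * (n + 1) + 1 = 2 * n + 1 + 2 by ring, hrec, h2]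
    rw [show 2 * n + 1 + 1 = 2 * (n + 1) by ring]
    ring

theorem exists_odd_mul_of_even_x_zpow {d : ℤ} (a : Solution₁ d) (n : ℤ) (h : Even (a ^ n).x) :
    ∃ c, Odd c ∧ (a ^ n).x = a.x * c := by
  have hnat : ∀ n : ℕ, Even (a ^ n).x → ∃ c, Odd c ∧ (a ^ n).x = a.x * c := by
    intro n hn
    rcases Nat.even_or_odd' n with ⟨k, rfl | rfl⟩
    · exact absurd (odd_x_and_exists_of_pow a k).1 (Int.not_odd_iff_even.mpr hn)
    · exact (odd_x_and_exists_of_pow a k).2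
  rcases n.eq_nat_or_neg with ⟨k, rfl | rfl⟩
  · rw [zpow_natCast] at h ⊢; exact hnat k h
  · rw [zpow_neg, zpow_natCast, x_inv] at h ⊢; exact hnat k h

end Pell.Solution₁

/-- All even first coordinates of solutions of a Pell equation have the same `2`-adic valuation. -/
theorem two_pow_dvd_of_pell (d : ℤ) (hd0 : 0 < d) (hd : ¬ IsSquare d) (F G T V : ℤ)
    (hF : F ^ 2 - d * G ^ 2 = 1) (hT : T ^ 2 - d * V ^ 2 = 1) (hTe : Even T) (m : ℕ) (hm : m ≠ 0)
    (h : 2 ^ m ∣ F) : 2 ^ m ∣ T := by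
  obtain ⟨a, ha⟩ := Pell.IsFundamental.exists_of_not_isSquare hd0 hd
  have key : ∀ z w : ℤ, z ^ 2 - d * w ^ 2 = 1 → Even z → ∃ c, Odd c ∧ z = a.x * c := by
    intro z w hzw hz
    obtain ⟨n, hn | hn⟩ := ha.eq_zpow_or_neg_zpow (Pell.Solution₁.mk z w hzw)
    · have hx := congrArg Pell.Solution₁.x hn
      rw [Pell.Solution₁.x_mk] at hx
      rw [hx] at hz ⊢
      exact Pell.Solution₁.exists_odd_mul_of_even_x_zpow a n hz
    · have hx := congrArg Pell.Solution₁.x hn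
      rw [Pell.Solution₁.x_mk, Pell.Solution₁.x_neg] at hx
      rw [hx, even_neg] at hz
      obtain ⟨c, hc, h'⟩ := Pell.Solution₁.exists_odd_mul_of_even_x_zpow a n hz
      exact ⟨-c, hc.neg, by rw [hx, h']; ring⟩
  obtain ⟨c, hc, hFc⟩ := key F G hF (even_iff_two_dvd.mpr ((dvd_pow_self 2 hm).trans h))
  obtain ⟨c', -, hTc⟩ := key T V hT hTe
  rw [hFc] at h
  have hcop : IsCoprime ((2 : ℤ) ^ m) c :=
    (Int.isCoprime_two_left.mpr hc).pow_left
  rw [hTc]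
  exact (hcop.dvd_of_dvd_mul_right h).mul_right c'

end

/-- Multiplication of Gaussian integers modulo `q`, on pairs of natural numbers. -/
def gaussMulMod (q : ℕ) (x y : ℕ × ℕ) : ℕ × ℕ :=
  ((x.1 * y.1 + (q - 1) * (x.2 * y.2)) % q, (x.1 * y.2 + x.2 * y.1) % q)

/-- Powers of Gaussian integers modulo `q` by repeated squaring; the first argument bounds
the number of binary digits of the exponent. -/
def gaussPowMod (q : ℕ) : ℕ → ℕ × ℕ → ℕ → ℕ × ℕ
  | 0, _, _ => (1, 0)
  | f + 1, x, n =>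
    match n % 2 with
    | 0 => gaussPowMod q f (gaussMulMod q x x) (n / 2)
    | _ => gaussMulMod q x (gaussPowMod q f (gaussMulMod q x x) (n / 2))

/-- The pair `x` of natural numbers represents the Gaussian integer `z` modulo `q`. -/
def RepresentsMod (q : ℕ) (x : ℕ × ℕ) (z : GaussianInt) : Prop :=
  (x.1 : ZMod q) = z.re ∧ (x.2 : ZMod q) = z.im

theorem RepresentsMod.mul {q : ℕ} (hq : 0 < q) {x y : ℕ × ℕ} {z w : GaussianInt}
    (hx : RepresentsMod q x z) (hy : RepresentsMod q y w) :
    RepresentsMod q (gaussMulMod q x y) (z * w) := by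
  obtain ⟨hx1, hx2⟩ := hx
  obtain ⟨hy1, hy2⟩ := hy
  have h1 : ((q - 1 : ℕ) : ZMod q) = -1 := by rw [Nat.cast_sub hq]; simp
  constructor
  · simp only [gaussMulMod, ZMod.natCast_mod, Nat.cast_add, Nat.cast_mul, h1, hx1, hx2, hy1, hy2,
      Zsqrtd.re_mul]
    push_cast
    ring
  · simp only [gaussMulMod, ZMod.natCast_mod, Nat.cast_add, Nat.cast_mul, hx1, hx2, hy1, hy2,
      Zsqrtd.im_mul]
    push_cast
    ring

theorem RepresentsMod.pow {q : ℕ} (hq : 0 < q) (f : ℕ) :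
    ∀ {x : ℕ × ℕ} {z : GaussianInt} (n : ℕ), n < 2 ^ f → RepresentsMod q x z →
      RepresentsMod q (gaussPowMod q f x n) (z ^ n) := by
  induction f with
  | zero =>
    intro x z n hn _
    have : n = 0 := by simpa using hn
    subst this
    simp [gaussPowMod, RepresentsMod]
  | succ f ih =>
    intro x z n hn hx
    have h1 := ih (n / 2) (by rw [pow_succ] at hn; omega) (hx.mul hq hx)
    rw [← pow_two, ← pow_mul] at h1
    rcases Nat.mod_two_eq_zero_or_one n with h | h
    · rw [gaussPowMod, h]
      rwa [show 2 * (n / 2) = n by omega] at h1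
    · rw [gaussPowMod, h]
      have h2 := hx.mul hq h1
      rwa [← pow_succ', show 2 * (n / 2) + 1 = n by omega] at h2

/-- Some small modulus excludes `(a + 2 ^ m i) ^ p` having imaginary part `-2 ^ m`. -/
def hasObstruction (p m : ℕ) : Bool :=
  [7, 11, 13, 17, 19, 23, 29, 37, 43, 47].any fun q =>
    (List.range q).all fun a => !Nat.beq (((gaussPowMod q 11 (a, 2 ^ m % q) p).2 + 2 ^ m % q) % q) 0

/-- Search of a solution of `r ^ 2 = p * s ^ 2 + 2` among the convergents of `√p`; `c` is the
integer part of `√p` and the continued fraction state is `(u + √p) / v`. -/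
def searchPellTwo (p c : ℕ) : ℕ → ℕ → ℕ → ℕ → ℕ → ℕ → ℕ → ℕ × ℕ
  | 0, _, _, r, s, _, _ => (r, s)
  | f + 1, u, v, r, s, r', s' =>
    match r * r - p * (s * s) with
    | 2 => (r, s)
    | _ =>
      let a := (u + c) / v
      let u' := a * v - u
      searchPellTwo p c f u' ((p - u' * u') / v) (a * r + r') (a * s + s') r s

/-- The verification that excludes `(a + 2 ^ m i) ^ p` having imaginary part `-2 ^ m` for all
`2 ≤ m` by means of a solution of `r ^ 2 = p * s ^ 2 + 2`. -/
def checkPrime (p r s : ℕ) : Bool :=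
  Nat.beq (r * r) (p * (s * s) + 2) && !Nat.beq ((r * r - 1) % 1024) 0 &&
    [2, 3, 4, 5, 6, 7, 8, 9].all fun m =>
      !Nat.beq ((r * r - 1) % 2 ^ m) 0 || hasObstruction p m

/-- Either `p` has a small proper divisor or it passes the verification `checkPrime`. -/
def checkNumber (p : ℕ) : Bool :=
  ([3, 5, 7, 11, 13, 17, 19, 23, 29, 31, 37, 41, 43].any fun d =>
    Nat.ble (d + 1) p && Nat.beq (p % d) 0) ||
    let c := (List.range 45).foldl (fun c i => bif Nat.ble (i * i) p then i else c) 0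
    let x := searchPellTwo p c 50 0 1 1 0 0 1
    checkPrime p x.1 x.2

theorem checkNumber_eq_true : ((List.range 250).all fun k => checkNumber (8 * k + 7)) = true := by
  decide +kernel

theorem natBeq_eq_true_iff {a b : ℕ} : Nat.beq a b = true ↔ a = b :=
  ⟨Nat.eq_of_beq_eq_true, fun h => by rw [h, Nat.beq_refl]⟩

theorem natBeq_eq_false_iff {a b : ℕ} : Nat.beq a b = false ↔ a ≠ b := by
  rw [← Bool.not_eq_true, natBeq_eq_true_iff]

theorem not_im_pow_of_hasObstruction (p m : ℕ) (hp : p < 2 ^ 11) (h : hasObstruction p m = true)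
    (g : GaussianInt) (him : g.im = 2 ^ m) : (g ^ p).im ≠ -g.im := by
  intro hneg
  simp only [hasObstruction, List.any_eq_true, List.all_eq_true, List.mem_range] at h
  obtain ⟨q, hq, h⟩ := h
  have hq0 : 0 < q := by
    rcases Nat.eq_zero_or_pos q with rfl | h0
    · simp at hq
    · exact h0
  have hr0 : 0 ≤ g.re % (q : ℤ) := Int.emod_nonneg _ (by omega)
  have hr1 : g.re % (q : ℤ) < q := Int.emod_lt_of_pos _ (by omega)
  have hrep : RepresentsMod q ((g.re % (q : ℤ)).toNat, 2 ^ m % q) g := by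
    constructor
    · have : (((g.re % (q : ℤ)).toNat : ℤ) : ZMod q) = (g.re : ZMod q) := by
        rw [Int.toNat_of_nonneg hr0, ZMod.intCast_mod]
      exact_mod_cast this
    · simp [him]
  have h1 := (hrep.pow hq0 11 p hp).2
  have h2 := h (g.re % (q : ℤ)).toNat (by omega)
  rw [Bool.not_eq_true', natBeq_eq_false_iff] at h2
  apply h2
  apply Nat.mod_eq_zero_of_dvd
  rw [← ZMod.natCast_eq_zero_iff, Nat.cast_add, h1, hneg, him]
  simp

theorem im_pow_ne_neg_im_of_checkPrime (p r s : ℕ) (hpr : p.Prime) (hp8 : p % 8 = 7)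
    (hp : p < 2 ^ 11) (h : checkPrime p r s = true) (g : GaussianInt) (m : ℕ) (hm : 2 ≤ m)
    (him : g.im = 2 ^ m) : (g ^ p).im ≠ -g.im := by
  intro hneg
  simp only [checkPrime, Bool.and_eq_true, natBeq_eq_true_iff, Bool.not_eq_true',
    natBeq_eq_false_iff] at h
  obtain ⟨⟨hrs, h1024⟩, hall⟩ := h
  have him0 : g.im ≠ 0 := by rw [him]; positivity
  obtain ⟨c, G, hF⟩ := exists_pell_of_im_pow_eq_neg_im p hpr (by omega) (by omega) g him0 hneg
  have hsq : ¬ IsSquare (p : ℤ) := by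
    rw [Int.isSquare_natCast_iff]
    exact hpr.prime.irreducible.not_isSquare
  have hrs' : (r : ℤ) * r = p * (s * s) + 2 := by exact_mod_cast hrs
  have hT : ((r : ℤ) * r - 1) ^ 2 - p * ((r : ℤ) * s) ^ 2 = 1 := by
    linear_combination ((r : ℤ) * r) * hrs'
  have hodd : r % 2 = 1 := by
    by_contra hr
    obtain ⟨t, rfl⟩ : ∃ t, r = 2 * t := ⟨r / 2, by omega⟩
    obtain ⟨k, rfl⟩ : ∃ k, p = 8 * k + 7 := ⟨p / 8, by omega⟩
    have h4 : (7 * (s * s) + 2) % 4 = 0 := by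
      have : 2 * t * (2 * t) = 8 * (k * (s * s)) + (7 * (s * s) + 2) := by rw [hrs]; ring
      have h5 : 2 * t * (2 * t) = 4 * (t * t) := by ring
      omega
    have : s % 4 = 0 ∨ s % 4 = 1 ∨ s % 4 = 2 ∨ s % 4 = 3 := by omega
    rcases this with h | h | h | h <;> simp [Nat.add_mod, Nat.mul_mod, h] at h4
  have hrodd : Odd (r : ℤ) := by exact_mod_cast Nat.odd_iff.2 hodd
  have hTe : Even ((r : ℤ) * r - 1) := (hrodd.mul hrodd).sub_odd odd_one
  have hdvd : (2 : ℤ) ^ m ∣ (r : ℤ) * r - 1 :=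
    two_pow_dvd_of_pell p (by exact_mod_cast hpr.pos) hsq _ G _ _ hF hT hTe m (by omega)
      (by rw [him]; exact Dvd.intro _ rfl)
  have hr1 : 1 ≤ r * r := by
    have : 0 < r := by omega
    exact Nat.mul_pos this this
  have hdvd' : 2 ^ m ∣ r * r - 1 := by
    rw [← Int.natCast_dvd_natCast, Nat.cast_sub hr1]
    exact_mod_cast hdvd
  have hm9 : m ≤ 9 := by
    by_contra hcon
    exact h1024 (Nat.mod_eq_zero_of_dvd ((pow_dvd_pow 2 (by omega : 10 ≤ m)).trans hdvd'))
  rw [List.all_eq_true] at hall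
  have hobs := hall m (by interval_cases m <;> simp)
  rw [Nat.mod_eq_zero_of_dvd hdvd'] at hobs
  exact not_im_pow_of_hasObstruction p m hp (by simpa using hobs) g him hneg

theorem im_pow_ne_neg_im_of_small_prime (p : ℕ) (hpr : p.Prime) (hp8 : p % 8 = 7)
    (hp : p < 2000) (g : GaussianInt) (m : ℕ) (hm : 2 ≤ m) (him : |g.im| = 2 ^ m) :
    (g ^ p).im ≠ -g.im := by
  wlog hpos : g.im = 2 ^ m generalizing g
  · intro hneg
    have hg : g.im = -2 ^ m := ((abs_eq (by positivity)).1 him).resolve_left hpos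
    refine this (star g) (by simpa using him) (by simp [hg]) ?_
    have : (star g ^ p).im = -(g ^ p).im := by rw [← star_pow]; rfl
    rw [this, hneg]
    rfl
  have h := List.all_eq_true.1 checkNumber_eq_true (p / 8) (List.mem_range.2 (by omega))
  rw [show 8 * (p / 8) + 7 = p by omega, checkNumber, Bool.or_eq_true] at h
  rcases h with h | h
  · exfalso
    simp only [List.any_eq_true, Bool.and_eq_true, natBeq_eq_true_iff] at h
    obtain ⟨d, hd, hle, hmod⟩ := h
    have hle' := Nat.le_of_ble_eq_true hle
    have := (Nat.dvd_prime hpr).1 (Nat.dvd_of_mod_eq_zero hmod)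
    rcases this with rfl | rfl
    · simp at hd
    · omega
  · exact im_pow_ne_neg_im_of_checkPrime p _ _ hpr hp8 (by omega) h g m hm hpos

namespace ZsqrtdNegTwo

/-- Nearest integer to `c / n`. -/
def nearest (c n : ℤ) : ℤ := (2 * c + n) / (2 * n)

theorem four_mul_sq_sub_nearest_le (c n : ℤ) (hn : 0 < n) :
    4 * (c - n * nearest c n) ^ 2 ≤ n ^ 2 := by
  have h1 := Int.emod_add_mul_ediv (2 * c + n) (2 * n)
  have h2 := Int.emod_nonneg (2 * c + n) (by omega : 2 * n ≠ 0)
  have h3 := Int.emod_lt_of_pos (2 * c + n) (by omega : 0 < 2 * n)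
  rw [nearest]
  nlinarith

/-- Division with remainder in `ℤ√(-2)`: the quotient. -/
def quot (x y : ℤ√(-2)) : ℤ√(-2) :=
  ⟨nearest (x * star y).re y.norm, nearest (x * star y).im y.norm⟩

theorem norm_eq (x : ℤ√(-2)) : x.norm = x.re ^ 2 + 2 * x.im ^ 2 := by
  rw [Zsqrtd.norm_def]
  ring

theorem norm_pos {x : ℤ√(-2)} (hx : x ≠ 0) : 0 < x.norm := by
  refine lt_of_le_of_ne (Zsqrtd.norm_nonneg (by norm_num) x) fun h => hx ?_
  exact (Zsqrtd.norm_eq_zero_iff (by norm_num) x).1 h.symm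

theorem norm_sub_mul_quot_lt (x : ℤ√(-2)) {y : ℤ√(-2)} (hy : y ≠ 0) :
    (x - y * quot x y).norm < y.norm := by
  have hn := norm_pos hy
  have h1 : (x - y * quot x y) * star y = x * star y - (y.norm : ℤ√(-2)) * quot x y := by
    rw [Zsqrtd.norm_eq_mul_conj]
    ring
  have h2 := congrArg Zsqrtd.norm h1
  rw [Zsqrtd.norm_mul, Zsqrtd.norm_conj, norm_eq (x * star y - _)] at h2
  simp only [Zsqrtd.re_sub, Zsqrtd.im_sub, Zsqrtd.re_smul, Zsqrtd.im_smul] at h2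
  have h3 := four_mul_sq_sub_nearest_le (x * star y).re y.norm hn
  have h4 := four_mul_sq_sub_nearest_le (x * star y).im y.norm hn
  have h5 : 4 * ((x - y * quot x y).norm * y.norm) ≤ 3 * y.norm ^ 2 := by
    rw [h2]
    simp only [quot]
    linarith
  nlinarith

instance : EuclideanDomain (ℤ√(-2)) :=
  { (inferInstance : CommRing (ℤ√(-2))), (inferInstance : Nontrivial (ℤ√(-2))) with
    quotient := quot
    remainder := fun x y => x - y * quot x y
    quotient_zero := fun x => by ext <;> simp [quot, nearest]
    quotient_mul_add_remainder_eq := fun _ _ => by ring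
    r := fun x y => x.norm.natAbs < y.norm.natAbs
    r_wellFounded := (measure (Int.natAbs ∘ Zsqrtd.norm)).wf
    remainder_lt := fun x y hy => by
      have h1 := norm_sub_mul_quot_lt x hy
      have h2 := Zsqrtd.norm_nonneg (by norm_num) (x - y * quot x y)
      omega
    mul_left_not_lt := fun a b hb => by
      have h1 := norm_pos hb
      rw [Zsqrtd.norm_mul, Int.natAbs_mul, not_lt]
      exact Nat.le_mul_of_pos_right _ (by omega) }

end ZsqrtdNegTwo

/-- Multiplicities of the imaginary part are absorbed into the radicand. -/
theorem re_pow_and_im_pow_eq {d : ℤ} (g : ℤ√d) (n : ℕ) :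
    (g ^ n).re = ((⟨g.re, 1⟩ : ℤ√(d * g.im ^ 2)) ^ n).re ∧
      (g ^ n).im = g.im * ((⟨g.re, 1⟩ : ℤ√(d * g.im ^ 2)) ^ n).im := by
  induction n with
  | zero => simp
  | succ n ih =>
    obtain ⟨h1, h2⟩ := ih
    constructor
    · simp only [pow_succ, Zsqrtd.re_mul, h1, h2]
      ring
    · simp only [pow_succ, Zsqrtd.im_mul, h1, h2]
      ring

section
variable {e : ℤ} (a : ℤ)

theorem dvd_re_pow_sub_and_dvd_im_pow_sub {M : ℤ} (hM : M ∣ e) (n : ℕ) :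
    M ∣ ((⟨a, 1⟩ : ℤ√e) ^ (n + 1)).re - a ^ (n + 1) ∧
      M ∣ ((⟨a, 1⟩ : ℤ√e) ^ (n + 1)).im - (n + 1) * a ^ n := by
  induction n with
  | zero => simp
  | succ n ih =>
    obtain ⟨⟨r, hr⟩, ⟨s, hs⟩⟩ := ih
    obtain ⟨k, rfl⟩ := hM
    rw [pow_succ _ (n + 1), Zsqrtd.re_mul, Zsqrtd.im_mul, sub_eq_iff_eq_add.1 hr,
      sub_eq_iff_eq_add.1 hs]
    refine ⟨⟨r * a + k * (M * s + (n + 1) * a ^ n), ?_⟩, ⟨r + s * a, ?_⟩⟩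
    · push_cast; ring
    · push_cast; ring

theorem dvd_re_pow_odd (k : ℕ) : a ∣ ((⟨a, 1⟩ : ℤ√e) ^ (2 * k + 1)).re := by
  induction k with
  | zero => simp
  | succ k ih =>
    obtain ⟨c, hc⟩ := ih
    rw [show 2 * (k + 1) + 1 = (2 * k + 1) + 1 + 1 by ring, pow_succ, pow_succ]
    simp only [Zsqrtd.re_mul, Zsqrtd.im_mul, hc]
    exact ⟨a * c * a + e * ((⟨a, 1⟩ : ℤ√e) ^ (2 * k + 1)).im + e * c +
      e * ((⟨a, 1⟩ : ℤ√e) ^ (2 * k + 1)).im, by ring⟩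

theorem re_pow_odd_mod_three (he : 3 ∣ e - 1) (k : ℕ) :
    3 ∣ ((⟨a, 1⟩ : ℤ√e) ^ (2 * k + 1)).re - a ∧ 3 ∣ ((⟨a, 1⟩ : ℤ√e) ^ (2 * k + 1)).im - 1 := by
  induction k with
  | zero => simp
  | succ k ih =>
    obtain ⟨⟨r, hr⟩, ⟨s, hs⟩⟩ := ih
    obtain ⟨c, hc⟩ := he
    have ha : (3 : ℤ) ∣ a ^ 3 - a := by
      have : a % 3 = 0 ∨ a % 3 = 1 ∨ a % 3 = 2 := by omega
      apply Int.dvd_of_emod_eq_zero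
      rcases this with h | h | h <;> simp [pow_succ, Int.sub_emod, Int.mul_emod, h]
    obtain ⟨t, ht⟩ := ha
    obtain rfl : e = 3 * c + 1 := by linarith
    rw [show 2 * (k + 1) + 1 = (2 * k + 1) + 1 + 1 by ring, pow_succ, pow_succ]
    simp only [Zsqrtd.re_mul, Zsqrtd.im_mul, sub_eq_iff_eq_add.1 hr, sub_eq_iff_eq_add.1 hs]
    constructor
    · refine ⟨r * (a ^ 2 + 3 * c + 1) + t + a * c + a + 2 * a * c + 2 * a * s * (3 * c + 1), ?_⟩
      linear_combination ht
    · refine ⟨2 * a * r + a ^ 2 + s * (a ^ 2 + 3 * c + 1) + c, ?_⟩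
      ring

theorem exists_pow_two_pow (ha : Odd a) (he : 4 ∣ e) (t : ℕ) :
    ∃ r s : ℤ, ((⟨a, 1⟩ : ℤ√e) ^ 2 ^ (t + 1)).re = 1 + 2 ^ (t + 2) * r ∧
      ((⟨a, 1⟩ : ℤ√e) ^ 2 ^ (t + 1)).im = 2 ^ (t + 1) * (2 * s + 1) := by
  induction t with
  | zero =>
    obtain ⟨b, rfl⟩ := ha
    obtain ⟨c, rfl⟩ := he
    exact ⟨b ^ 2 + b + c, b, by simp [pow_two]; ring, by simp [pow_two]; ring⟩
  | succ t ih =>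
    obtain ⟨r, s, hr, hs⟩ := ih
    obtain ⟨c, rfl⟩ := he
    rw [pow_succ 2 (t + 1), pow_mul, pow_two (_ ^ _)]
    simp only [Zsqrtd.re_mul, Zsqrtd.im_mul, hr, hs]
    refine ⟨r + 2 ^ (t + 1) * r ^ 2 + 2 ^ (t + 1) * c * (2 * s + 1) ^ 2,
      s + 2 ^ (t + 1) * r * (2 * s + 1), ?_, ?_⟩ <;> ring

theorem exists_pow_two_pow_mul (ha : Odd a) (he : 4 ∣ e) (t m : ℕ) :
    ∃ r s : ℤ, ((⟨a, 1⟩ : ℤ√e) ^ (2 ^ (t + 1) * m)).re = 1 + 2 ^ (t + 2) * r ∧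
      ((⟨a, 1⟩ : ℤ√e) ^ (2 ^ (t + 1) * m)).im = 2 ^ (t + 1) * (2 * s + m) := by
  induction m with
  | zero => exact ⟨0, 0, by simp, by simp⟩
  | succ m ih =>
    obtain ⟨r, s, hr, hs⟩ := ih
    obtain ⟨r', s', hr', hs'⟩ := exists_pow_two_pow a ha he t
    obtain ⟨c, rfl⟩ := he
    rw [Nat.mul_succ, pow_add]
    simp only [Zsqrtd.re_mul, Zsqrtd.im_mul, hr, hs, hr', hs']
    refine ⟨r + r' + 2 ^ (t + 2) * r * r' + 2 ^ (t + 2) * c * (2 * s + m) * (2 * s' + 1),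
      s + s' + 2 ^ (t + 1) * (r * (2 * s' + 1) + r' * (2 * s + m)), ?_, ?_⟩
    · ring
    · push_cast; ring

theorem im_pow_odd_ne_one (ha : Odd a) (he : 4 ∣ e) (p : ℕ) (hp : Odd p) (hp1 : p ≠ 1) :
    ((⟨a, 1⟩ : ℤ√e) ^ p).im ≠ 1 := by
  intro h
  obtain ⟨k, rfl⟩ := hp
  obtain ⟨t, m, hm, hk⟩ := Nat.exists_eq_two_pow_mul_odd (n := k) (by omega)
  obtain ⟨r, s, hr, hs⟩ := exists_pow_two_pow_mul a ha he t m
  obtain ⟨b, rfl⟩ := ha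
  obtain ⟨j, rfl⟩ := hm
  rw [show 2 * k + 1 = 2 ^ (t + 1) * (2 * j + 1) + 1 by rw [hk]; ring, pow_succ, Zsqrtd.im_mul,
    hr, hs] at h
  have h1 : (2 : ℤ) ^ (t + 1) * ((2 * s + (2 * j + 1)) * (2 * b + 1) + 2 * r) = 0 := by
    push_cast at h
    linear_combination h
  have h2 := (mul_eq_zero.1 h1).resolve_left (by positivity)
  have h3 : 2 * ((s + j) * (2 * b + 1) + b + r) + 1 = 0 := by linear_combination h2
  omega

end

section
variable {d : ℤ}

theorem unit_pow_four_eq_one (hd : d = -1 ∨ d = -2) (u : (ℤ√d)ˣ) : u ^ 4 = 1 := by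
  have h := (Zsqrtd.norm_eq_one_iff' (by omega) (u : ℤ√d)).2 u.isUnit
  obtain ⟨u, v, huv, hvu⟩ := u
  obtain ⟨a, b⟩ := u
  rw [Units.ext_iff]
  simp only [Zsqrtd.norm_def] at h
  simp only [Units.val_pow_eq_pow_val, Units.val_one]
  have hb : b ^ 2 ≤ 1 := by rcases hd with rfl | rfl <;> nlinarith
  have ha : a ^ 2 ≤ 1 := by rcases hd with rfl | rfl <;> nlinarith
  have hb1 : -1 ≤ b ∧ b ≤ 1 := abs_le.1 ((sq_le_one_iff_abs_le_one b).1 hb)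
  have ha1 : -1 ≤ a ∧ a ≤ 1 := abs_le.1 ((sq_le_one_iff_abs_le_one a).1 ha)
  obtain ⟨hb1, hb2⟩ := hb1
  obtain ⟨ha1, ha2⟩ := ha1
  clear huv hvu ha hb
  rcases hd with rfl | rfl <;> interval_cases a <;> interval_cases b <;>
    first | (exfalso; omega) | (ext <;> simp [pow_succ])

theorem exists_pow_eq_of_coprime [IsDomain (ℤ√d)] [IsBezout (ℤ√d)]
    (hd : d = -1 ∨ d = -2) {z w c : ℤ√d}
    (hzw : IsCoprime z w) {p : ℕ} (hp : Odd p) (h : z * w = c ^ p) : ∃ g, g ^ p = z := by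
  obtain ⟨g, u, hu⟩ := exists_associated_pow_of_mul_eq_pow' hzw h
  obtain ⟨k, rfl⟩ := hp
  refine ⟨g * (u ^ (2 * k + 1) : (ℤ√d)ˣ), ?_⟩
  rw [← hu, mul_pow, ← Units.val_pow_eq_pow_val, ← pow_mul,
    show (2 * k + 1) * (2 * k + 1) = 4 * (k ^ 2 + k) + 1 by ring, pow_succ u, pow_mul u,
    unit_pow_four_eq_one hd, one_pow, one_mul]

theorem exists_pow_eq_of_sq_sub_eq [IsDomain (ℤ√d)] [IsBezout (ℤ√d)]
    (hd : d = -1 ∨ d = -2) {x y : ℤ} {k p : ℕ}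
    (hy : Odd y) (hp : Odd p) (h : x ^ 2 - d * (2 ^ k) ^ 2 = y ^ p) :
    ∃ g : ℤ√d, g ^ p = ⟨x, 2 ^ k⟩ := by
  have hyp : Odd (y ^ p) := hy.pow
  have hcop2 : IsCoprime (2 : ℤ) (y ^ p) := (Int.isCoprime_two_left).2 hyp
  have hcopx : IsCoprime x (y ^ p) := by
    have hd4 : IsCoprime (d * (2 ^ k) ^ 2) (y ^ p) := by
      refine IsCoprime.mul_left ?_ hcop2.pow_left.pow_left
      rcases hd with rfl | rfl
      · exact isCoprime_one_left.neg_left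
      · exact hcop2.neg_left
    have : IsCoprime (x ^ 2) (y ^ p) := by
      obtain ⟨r, s, hrs⟩ := hd4
      exact ⟨r, s - r, by linear_combination hrs + r * h⟩
    exact (IsCoprime.pow_left_iff two_pos).1 this
  obtain ⟨r, s, hrs⟩ := hcop2.mul_left hcopx
  have hmul : (⟨x, 2 ^ k⟩ : ℤ√d) * star ⟨x, 2 ^ k⟩ = (y : ℤ√d) ^ p := by
    rw [← Zsqrtd.norm_eq_mul_conj, ← Int.cast_pow, ← h, Zsqrtd.norm_def]
    congr 1
    ring
  have hadd : (⟨x, 2 ^ k⟩ : ℤ√d) + star ⟨x, 2 ^ k⟩ = ((2 * x : ℤ) : ℤ√d) := by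
    ext
    · simp; ring
    · simp
  refine exists_pow_eq_of_coprime hd ?_ hp hmul
  have hrs' : (r : ℤ√d) * ((2 * x : ℤ) : ℤ√d) + s * (y : ℤ√d) ^ p = 1 := by exact_mod_cast hrs
  rw [← hmul, ← hadd] at hrs'
  exact ⟨r + s * star ⟨x, 2 ^ k⟩, r, by linear_combination hrs'⟩

theorem exists_pow_eq_and_im_pow [IsDomain (ℤ√d)] [IsBezout (ℤ√d)]
    (hd : d = -1 ∨ d = -2) {x y : ℤ} {k p : ℕ}
    (hx : Odd x) (hy : Odd y) (hp : Odd p) (h : x ^ 2 - d * (2 ^ k) ^ 2 = y ^ p) :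
    ∃ g : ℤ√d, Odd g.re ∧ |g.im| = 2 ^ k ∧
      (((⟨g.re, 1⟩ : ℤ√(d * g.im ^ 2)) ^ p).im = 1 ∨
        ((⟨g.re, 1⟩ : ℤ√(d * g.im ^ 2)) ^ p).im = -1) := by
  obtain ⟨g, hg⟩ := exists_pow_eq_of_sq_sub_eq hd hy hp h
  obtain ⟨h1, h2⟩ := re_pow_and_im_pow_eq g p
  rw [hg] at h1 h2
  obtain ⟨j, rfl⟩ := hp
  have hre : Odd g.re := by
    obtain ⟨c, hc⟩ := dvd_re_pow_odd (e := d * g.im ^ 2) g.re j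
    rw [← h1] at hc
    exact (Int.odd_mul.1 (hc ▸ hx : Odd (g.re * c))).1
  have heven : 2 ∣ d * g.im ^ 2 := by
    rcases hd with rfl | rfl
    · have hn : g.norm ^ (2 * j + 1) = y ^ (2 * j + 1) := by
        have h3 : (g ^ (2 * j + 1)).norm = g.norm ^ (2 * j + 1) := map_pow Zsqrtd.normMonoidHom _ _
        rw [← h, ← h3, hg, Zsqrtd.norm_def]
        ring
      have hodd : Odd g.norm := by
        by_contra hcon
        rw [Int.not_odd_iff_even] at hcon
        have h3 := hy.pow (n := 2 * j + 1)
        rw [← hn] at h3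
        exact (Int.not_even_iff_odd.2 h3) (hcon.pow_of_ne_zero (by omega))
      rw [Zsqrtd.norm_def] at hodd
      have : Even (g.re * g.re - (g.re * g.re - -1 * g.im * g.im)) := (hre.mul hre).sub_odd hodd
      have h5 := this.two_dvd
      rwa [show g.re * g.re - (g.re * g.re - -1 * g.im * g.im) = -1 * g.im ^ 2 by ring] at h5
    · exact ⟨-g.im ^ 2, by ring⟩
  have hU : Odd ((⟨g.re, 1⟩ : ℤ√(d * g.im ^ 2)) ^ (2 * j + 1)).im := by
    obtain ⟨c, hc⟩ := (dvd_re_pow_sub_and_dvd_im_pow_sub g.re heven (2 * j)).2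
    obtain ⟨b, hb⟩ := hre.pow (n := 2 * j)
    rw [sub_eq_iff_eq_add.1 hc, hb]
    exact ⟨c + 2 * j * b + j + b, by push_cast; ring⟩
  set U := ((⟨g.re, 1⟩ : ℤ√(d * g.im ^ 2)) ^ (2 * j + 1)).im with hUdef
  have h2' : (2 : ℤ) ^ k = g.im * U := h2
  have hUunit : IsUnit U := by
    have hcop : IsCoprime U (2 ^ k) := ((Int.isCoprime_two_right).2 hU).pow_right
    exact hcop.isUnit_of_dvd' dvd_rfl (h2' ▸ Dvd.intro_left _ rfl)
  refine ⟨g, hre, ?_, Int.isUnit_iff.1 hUunit⟩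
  rcases Int.isUnit_iff.1 hUunit with h3 | h3 <;> rw [h3] at h2'
  · rw [show g.im = 2 ^ k by linarith, abs_of_pos (by positivity)]
  · rw [show g.im = -2 ^ k by linarith, abs_neg, abs_of_pos (by positivity)]

end

theorem sq_add_two_pow_odd_ne_pow {x y : ℤ} {k p : ℕ} (hx : Odd x) (hy : Odd y) (hp : Odd p)
    (hp1 : p ≠ 1) (hk : k ≠ 0) : x ^ 2 + 2 ^ (2 * k + 1) ≠ y ^ p := by
  intro h
  obtain ⟨g, hre, him, hU⟩ := exists_pow_eq_and_im_pow (d := -2) (Or.inr rfl) (k := k) hx hy hp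
    (by rw [← h]; ring)
  obtain ⟨k, rfl⟩ := Nat.exists_eq_succ_of_ne_zero hk
  have hsq : g.im ^ 2 = 4 ^ (k + 1) := by
    rw [← sq_abs, him, ← pow_mul, mul_comm, pow_mul]; norm_num
  rw [hsq] at hU
  rcases hU with hU | hU
  · exact im_pow_odd_ne_one g.re hre ⟨-2 * 4 ^ k, by ring⟩ p hp hp1 hU
  · obtain ⟨j, rfl⟩ := hp
    have h3 : (3 : ℤ) ∣ -2 * 4 ^ (k + 1) - 1 := by
      have h4 : (3 : ℤ) ∣ 4 ^ (k + 1) - 1 := by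
        simpa using sub_dvd_pow_sub_pow (4 : ℤ) 1 (k + 1)
      omega
    have := (re_pow_odd_mod_three g.re h3 j).2
    rw [hU] at this
    omega

theorem sq_add_two_pow_even_ne_pow {x y : ℤ} {k p : ℕ} (hx : Odd x) (hy : Odd y) (hp : p.Prime)
    (hp2 : p ≠ 2) (hk : 2 ≤ k) : x ^ 2 + 2 ^ (2 * k) ≠ y ^ p := by
  intro h
  have hpo := hp.odd_of_ne_two hp2
  obtain ⟨g, hre, him, hU⟩ := exists_pow_eq_and_im_pow (d := -1) (Or.inl rfl) (k := k) hx hy hpo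
    (by rw [← h]; ring)
  obtain ⟨k, rfl⟩ := Nat.exists_eq_add_of_le hk
  have hsq : g.im ^ 2 = 16 * 4 ^ k := by
    rw [← sq_abs, him, ← pow_mul, mul_comm, pow_mul, pow_add]; norm_num
  have him0 : g.im ≠ 0 := by
    rintro h0
    rw [h0] at hsq
    have : (0 : ℤ) < 4 ^ k := by positivity
    omega
  have hgp := (re_pow_and_im_pow_eq g p).2
  have h8 : 8 ∣ -1 * g.im ^ 2 := ⟨-2 * 4 ^ k, by rw [hsq]; ring⟩
  rcases hU with hU | hU
  · exact im_pow_odd_ne_one g.re hre (dvd_trans (by norm_num) h8) p hpo hp.ne_one hU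
  · rw [hU] at hgp
    have hp8 : p % 8 = 7 := by
      obtain ⟨j, rfl⟩ := hpo
      obtain ⟨c, hc⟩ := (dvd_re_pow_sub_and_dvd_im_pow_sub g.re h8 (2 * j)).2
      rw [hU] at hc
      obtain ⟨b, hb⟩ : ∃ b, g.re ^ (2 * j) = 8 * b + 1 := by
        have h1 : (8 : ℤ) ∣ g.re ^ 2 - 1 := Int.eight_dvd_sq_sub_one_of_odd hre
        have h2 : g.re ^ 2 - 1 ∣ g.re ^ (2 * j) - 1 := by
          simpa [pow_mul] using sub_dvd_pow_sub_pow (g.re ^ 2) 1 j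
        obtain ⟨b, hb⟩ := h1.trans h2
        exact ⟨b, by linarith⟩
      rw [hb] at hc
      have h9 : (8 : ℤ) ∣ (2 * j + 1 : ℕ) + 1 := by
        refine ⟨-c - (2 * j + 1) * b, ?_⟩
        push_cast at hc ⊢
        linear_combination -hc
      omega
    rcases lt_or_ge p 2000 with hlt | hge
    · exact im_pow_ne_neg_im_of_small_prime p hp hp8 hlt g (2 + k) hk him (by rw [hgp]; ring)
    · have hnorm : g.norm = g.re * g.re + 16 * 4 ^ k := by
        rw [Zsqrtd.norm_def, ← hsq]; ring
      have hcop : IsCoprime g.re g.im := by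
        have h1 : IsCoprime g.re (2 ^ (2 + k)) := ((Int.isCoprime_two_right).2 hre).pow_right
        rw [← him] at h1
        rcases abs_choice g.im with h2 | h2 <;> rw [h2] at h1
        · exact h1
        · exact (IsCoprime.neg_right_iff _ _).1 h1
      refine abs_im_pow_ne_abs_im_of_large_prime g hcop ?_ ?_ him0 p hp hge ?_
      · rw [hnorm]
        exact (hre.mul hre).add_even ⟨8 * 4 ^ k, by ring⟩
      · have : (1 : ℤ) ≤ 4 ^ k := one_le_pow₀ (by norm_num)
        nlinarith [mul_self_nonneg g.re]
      · rw [hgp, mul_neg_one, abs_neg]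

theorem sq_add_two_pow_ne_pow {x y h n : ℕ} (hx : Odd x) (hy : Odd y) (hh : 2 < h) (hn : Odd n)
    (hn1 : n ≠ 1) : x ^ 2 + 2 ^ h ≠ y ^ n := by
  intro heq
  obtain ⟨p, hp, m, rfl⟩ := Nat.exists_prime_and_dvd hn1
  have hp2 : p ≠ 2 := by
    rintro rfl
    exact (Nat.not_even_iff_odd.2 hn) (even_two.mul_right m)
  have hxz : Odd (x : ℤ) := by exact_mod_cast hx
  have hyz : Odd ((y : ℤ) ^ m) := by exact_mod_cast hy.pow
  have heqz : (x : ℤ) ^ 2 + 2 ^ h = ((y : ℤ) ^ m) ^ p := by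
    rw [← pow_mul, mul_comm m p]
    exact_mod_cast heq
  rcases Nat.even_or_odd' h with ⟨k, rfl | rfl⟩
  · exact sq_add_two_pow_even_ne_pow hxz hyz hp hp2 (by omega) heqz
  · exact sq_add_two_pow_odd_ne_pow hxz hyz (hp.odd_of_ne_two hp2) hp.ne_one (by omega) heqz

theorem eq_three_of_pow_eq_two_pow_add_one {y j k : ℕ} (hj : 1 < j) (hk : 0 < k)
    (h : y ^ j = 2 ^ k + 1) : y = 3 ∧ j = 2 ∧ k = 3 := by
  have hyodd : Odd y := by
    have : Odd (y ^ j) := h ▸ (even_two.pow_of_ne_zero hk.ne').add_one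
    exact (Nat.odd_pow_iff (by omega)).1 this
  have hy1 : y ≠ 1 := by
    rintro rfl
    have := Nat.two_pow_pos k
    simp at h
  have hy3 : 3 ≤ y := by
    obtain ⟨t, rfl⟩ := hyodd
    omega
  rcases Nat.even_or_odd j with ⟨i, rfl⟩ | hjo
  · set z := y ^ i with hz
    have hi : i ≠ 0 := by omega
    have hz3 : 3 ≤ z := hy3.trans (Nat.le_self_pow hi y)
    have hfac : (z - 1) * (z + 1) = 2 ^ k := by
      obtain ⟨w, hw⟩ : ∃ w, z = w + 1 := ⟨z - 1, by omega⟩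
      rw [pow_add, ← hz, hw] at h
      rw [hw, Nat.add_sub_cancel]
      linarith
    obtain ⟨r, -, hr⟩ := (Nat.dvd_prime_pow Nat.prime_two).1 (Dvd.intro _ hfac)
    obtain ⟨s, -, hs⟩ := (Nat.dvd_prime_pow Nat.prime_two).1 (Dvd.intro_left _ hfac)
    have hr1 : r = 1 := by
      rcases Nat.lt_or_ge r 2 with h2 | h2
      · interval_cases r
        · simp at hr; omega
        · rfl
      · exfalso
        have hs2 : 2 ≤ s := by
          by_contra hcon
          interval_cases s <;> omega
        have h4r : 4 ∣ 2 ^ r := pow_dvd_pow 2 h2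
        have h4s : 4 ∣ 2 ^ s := pow_dvd_pow 2 hs2
        omega
    subst hr1
    have hz' : z = 3 := by omega
    have hi1 : i = 1 := by
      by_contra hcon
      have h1 : 3 ^ 2 ≤ y ^ i :=
        (Nat.pow_le_pow_left hy3 2).trans (Nat.pow_le_pow_right (by omega) (by omega))
      omega
    subst hi1
    rw [pow_one] at hz
    refine ⟨by omega, rfl, ?_⟩
    have : 2 ^ k = 2 ^ 3 := by rw [← hfac, hz']; norm_num
    exact Nat.pow_right_injective le_rfl this
  · exfalso
    have hgeom : (y - 1) * ∑ i ∈ Finset.range j, y ^ i = 2 ^ k := by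
      obtain ⟨w, rfl⟩ : ∃ w, y = w + 1 := ⟨y - 1, by omega⟩
      have h1 := geom_sum_mul_add w j
      rw [Nat.add_sub_cancel, mul_comm]
      omega
    have hodd : Odd (∑ i ∈ Finset.range j, y ^ i) := by
      rw [Finset.odd_sum_iff_odd_card_odd]
      simpa [hyodd.pow] using hjo
    have hone : ∑ i ∈ Finset.range j, y ^ i = 1 := by
      have hc : Nat.Coprime (∑ i ∈ Finset.range j, y ^ i) (2 ^ k) :=
        (Nat.coprime_two_right.2 hodd).pow_right k
      exact Nat.eq_one_of_dvd_coprimes hc dvd_rfl (Dvd.intro_left _ hgeom)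
    have hlt : ∑ i ∈ Finset.range 2, y ^ i ≤ ∑ i ∈ Finset.range j, y ^ i :=
      Finset.sum_le_sum_of_subset (Finset.range_subset_range.2 hj)
    simp [Finset.sum_range_succ] at hlt
    omega

theorem eq_of_sq_add_two_pow_eq_sq {x z h : ℕ} (hx : Odd x) (hz : Odd z) (hh : 2 < h)
    (heq : x ^ 2 + 2 ^ h = z ^ 2) : x = 2 ^ (h - 2) - 1 ∧ z = 2 ^ (h - 2) + 1 := by
  have hlt : x < z := by
    have := Nat.two_pow_pos h
    exact lt_of_pow_lt_pow_left₀ 2 (by omega) (by omega)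
  obtain ⟨a, rfl⟩ := hx
  obtain ⟨b, rfl⟩ := hz
  obtain ⟨c, rfl⟩ : ∃ c, b = a + c := ⟨b - a, by omega⟩
  obtain ⟨k, rfl⟩ : ∃ k, h = k + 2 := ⟨h - 2, by omega⟩
  have hfac : c * (2 * a + c + 1) = 2 ^ k := by
    have : 4 * (c * (2 * a + c + 1)) = 4 * 2 ^ k := by
      rw [pow_add] at heq
      linarith
    omega
  obtain ⟨r, hr, hr'⟩ := (Nat.dvd_prime_pow Nat.prime_two).1 (Dvd.intro _ hfac)
  obtain ⟨s, hs, hs'⟩ := (Nat.dvd_prime_pow Nat.prime_two).1 (Dvd.intro_left _ hfac)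
  have hc1 : c = 1 := by
    rcases Nat.eq_zero_or_pos r with rfl | h0
    · simpa using hr'
    · exfalso
      have h2 : 2 ∣ 2 ^ r := dvd_pow_self 2 h0.ne'
      have hs1 : s = 0 := by
        by_contra hcon
        have h3 : 2 ∣ 2 ^ s := dvd_pow_self 2 hcon
        omega
      subst hs1
      omega
  subst hc1
  rw [Nat.add_sub_cancel, ← hfac]
  omega

/-- The only positive integer solutions `(x, y, h, n)` of `x^2 + 2^h = y^n`
with `n > 1`, `y` odd, `h > 2` are `(7, 3, 5, 4)` and
`(2^(h-2) - 1, 2^(h-2) + 1, h, 2)`. -/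
theorem x_sq_add_two_pow_eq_pow (x y h n : ℕ)
    (hx : 0 < x) (hy : 0 < y) (hyodd : Odd y) (hn : 1 < n) (hh : 2 < h)
    (heq : x ^ 2 + 2 ^ h = y ^ n) :
    (x = 7 ∧ y = 3 ∧ h = 5 ∧ n = 4) ∨
    (x = 2 ^ (h - 2) - 1 ∧ y = 2 ^ (h - 2) + 1 ∧ n = 2) := by
  have hxodd : Odd x := by
    have h1 : Odd (x ^ 2 + 2 ^ h) := heq ▸ hyodd.pow
    have h2 : Odd (x ^ 2) := (Nat.odd_add.1 h1).2 (even_two.pow_of_ne_zero (by omega))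
    exact (Nat.odd_pow_iff two_ne_zero).1 h2
  rcases Nat.even_or_odd' n with ⟨j, rfl | rfl⟩
  · rw [mul_comm, pow_mul] at heq
    obtain ⟨h1, h2⟩ := eq_of_sq_add_two_pow_eq_sq hxodd hyodd.pow hh heq
    rcases Nat.lt_or_ge 1 j with hj | hj
    · obtain ⟨rfl, rfl, h5⟩ := eq_three_of_pow_eq_two_pow_add_one hj (by omega) h2
      obtain rfl : h = 5 := by omega
      exact Or.inl ⟨by simpa using h1, rfl, rfl, rfl⟩
    · obtain rfl : j = 1 := by omega
      exact Or.inr ⟨h1, by simpa using h2, rfl⟩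
  · exact absurd heq (sq_add_two_pow_ne_pow hxodd hyodd hh ⟨j, rfl⟩ (by omega))
end

section
/- If x is an integer divisible by 5 and y, l are integers with y > 0, l > 1, l odd, satisfying x^2 − 125 = 4·y^l, then (x, y, l) = (±25, 5, 3). -/
open scoped QuadraticAlgebra

/-- The ring `ℤ[φ]` of integers of `ℚ(√5)`, where `φ ^ 2 = 1 + φ`. -/
abbrev GoldenInt := QuadraticAlgebra ℤ 1 1

namespace GoldenInt

theorem norm_eq (z : GoldenInt) : z.norm = z.re ^ 2 + z.re * z.im - z.im ^ 2 := by
  rw [QuadraticAlgebra.norm_def]; ring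

theorem norm_eq_zero {z : GoldenInt} (h : z.norm = 0) : z = 0 := by
  rw [norm_eq] at h
  have h5 : (2 * z.re + z.im) ^ 2 = 5 * z.im ^ 2 := by linear_combination 4 * h
  have him : z.im = 0 := by
    by_contra him
    have hR : ((2 * z.re + z.im : ℝ) / z.im) ^ 2 = 5 := by
      have : (z.im : ℝ) ≠ 0 := by exact_mod_cast him
      field_simp
      exact_mod_cast (by linarith [h5] : (2 * z.re + z.im) ^ 2 = z.im ^ 2 * 5)
    have hirr : Irrational √(5 : ℕ) := Nat.Prime.irrational_sqrt (by norm_num)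
    apply hirr
    refine ⟨|((2 * z.re + z.im : ℚ) / z.im)|, ?_⟩
    push_cast
    rw [← Real.sqrt_sq_eq_abs, hR]
  have hre : z.re = 0 := by
    have : z.re ^ 2 = 0 := by simpa [him] using h
    exact pow_eq_zero_iff two_ne_zero |>.1 this
  exact QuadraticAlgebra.ext hre him

/-- Division in `ℤ[φ]`: round both coordinates of the exact quotient. -/
def quo (w z : GoldenInt) : GoldenInt :=
  ⟨round (((w * star z).re : ℚ) / z.norm), round (((w * star z).im : ℚ) / z.norm)⟩

theorem two_mul_abs_sub_round_le (a n : ℤ) (hn : n ≠ 0) :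
    2 * |a - n * round ((a : ℚ) / n)| ≤ |n| := by
  have h := abs_sub_round ((a : ℚ) / n)
  have hn' : (n : ℚ) ≠ 0 := by exact_mod_cast hn
  have h2 : ((a : ℚ) - n * round ((a : ℚ) / n)) = n * ((a : ℚ) / n - round ((a : ℚ) / n)) := by
    field_simp
  have h3 : 2 * |(a : ℚ) - n * round ((a : ℚ) / n)| ≤ |(n : ℚ)| := by
    rw [h2, abs_mul]
    nlinarith [abs_nonneg (n : ℚ)]
  exact_mod_cast h3

theorem natAbs_norm_sub_lt (w : GoldenInt) {z : GoldenInt} (hz : z ≠ 0) :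
    (w - z * quo w z).norm.natAbs < z.norm.natAbs := by
  have hn : z.norm ≠ 0 := fun h => hz (norm_eq_zero h)
  have hs := two_mul_abs_sub_round_le (w * star z).re z.norm hn
  have ht := two_mul_abs_sub_round_le (w * star z).im z.norm hn
  set s := (w * star z).re - z.norm * round (((w * star z).re : ℚ) / z.norm) with hsdef
  set t := (w * star z).im - z.norm * round (((w * star z).im : ℚ) / z.norm) with htdef
  have hmul : (w - z * quo w z) * star z = ⟨s, t⟩ := by
    have h1 : (w - z * quo w z) * star z = w * star z - (z * star z) * quo w z := by ring
    rw [h1, ← QuadraticAlgebra.algebraMap_norm_eq_mul_star]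
    ext <;> simp [hsdef, htdef, quo]
  have hnorm : (w - z * quo w z).norm * z.norm = s ^ 2 + s * t - t ^ 2 := by
    rw [← QuadraticAlgebra.norm_star z, ← map_mul, hmul, norm_eq]
  set N := z.norm
  have hNpos : 0 < |N| := abs_pos.2 hn
  have hst : |s ^ 2 + s * t - t ^ 2| < |N| * |N| := by
    have h1 : |s| * |s| = s ^ 2 := by rw [abs_mul_abs_self]; ring
    have h2 : |t| * |t| = t ^ 2 := by rw [abs_mul_abs_self]; ring
    have h3 : |s * t| = |s| * |t| := abs_mul s t
    have h4 := abs_le.1 (le_of_eq h3)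
    have := abs_nonneg s
    have := abs_nonneg t
    have e1 : 4 * (|s| * |s|) ≤ |N| * |N| := by nlinarith
    have e2 : 4 * (|t| * |t|) ≤ |N| * |N| := by nlinarith
    have e3 : 4 * (|s| * |t|) ≤ |N| * |N| := by nlinarith
    have e4 : 0 < |N| * |N| := by positivity
    rw [abs_lt]
    constructor <;> nlinarith
  rw [← hnorm, abs_mul] at hst
  have hlt := lt_of_mul_lt_mul_right hst (abs_nonneg N)
  rwa [Int.abs_eq_natAbs, Int.abs_eq_natAbs, Nat.cast_lt] at hlt

instance : EuclideanDomain GoldenInt where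
  quotient := quo
  quotient_zero w := by ext <;> simp [quo]
  remainder w z := w - z * quo w z
  quotient_mul_add_remainder_eq w z := by ring
  r w z := w.norm.natAbs < z.norm.natAbs
  r_wellFounded := (measure fun z : GoldenInt => z.norm.natAbs).wf
  remainder_lt w _ hz := natAbs_norm_sub_lt w hz
  mul_left_not_lt w z hz := by
    have hn : z.norm ≠ 0 := fun h => hz (norm_eq_zero h)
    rw [not_lt, map_mul, Int.natAbs_mul]
    exact Nat.le_mul_of_pos_right _ (Int.natAbs_pos.2 hn)

/-- The golden ratio as a unit of `ℤ[φ]`. -/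
def phi : GoldenIntˣ where
  val := ⟨0, 1⟩
  inv := ⟨-1, 1⟩
  val_inv := by ext <;> simp
  inv_val := by ext <;> simp

/-- The embedding of `ℤ[φ]` into `ℝ` sending `φ` to the golden ratio. -/
noncomputable def toReal : GoldenInt →+* ℝ :=
  (QuadraticAlgebra.lift ⟨Real.goldenRatio, by
    rw [← sq, Real.goldenRatio_sq, one_smul, one_smul, add_comm]⟩ : GoldenInt →ₐ[ℤ] ℝ)

theorem toReal_apply (z : GoldenInt) : toReal z = z.re + z.im * Real.goldenRatio := by
  simp [toReal]

theorem toReal_mul_toReal_star (z : GoldenInt) : toReal z * toReal (star z) = z.norm := by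
  rw [← map_mul, ← QuadraticAlgebra.algebraMap_norm_eq_mul_star]
  simp

theorem eq_one_of_isUnit_of_toReal_mem {z : GoldenInt} (hz : IsUnit z) (h1 : 1 ≤ toReal z)
    (h2 : toReal z < Real.goldenRatio) : z = 1 := by
  have hN : |(z.norm : ℝ)| = 1 := by
    have := Int.isUnit_iff_abs_eq.1 (QuadraticAlgebra.isUnit_iff_norm_isUnit.1 hz)
    exact_mod_cast this
  rw [← toReal_mul_toReal_star, abs_mul, abs_of_pos (by linarith)] at hN
  have hs : |toReal (star z)| ≤ 1 := by nlinarith [abs_nonneg (toReal (star z))]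
  rw [abs_le] at hs
  have e1 := toReal_apply z
  have e2 := toReal_apply (star z)
  simp only [QuadraticAlgebra.re_star, QuadraticAlgebra.im_star] at e2
  push_cast at e2
  have hφ : (1.61 : ℝ) < Real.goldenRatio ∧ Real.goldenRatio < 1.62 := by
    constructor <;> nlinarith [Real.goldenRatio_sq, Real.goldenRatio_pos]
  have hb1 : z.im < 2 := by
    by_contra! h
    have : (2 : ℝ) ≤ z.im := by exact_mod_cast h
    nlinarith
  have hb0 : -1 < z.im := by
    by_contra! h
    have : (z.im : ℝ) ≤ -1 := by exact_mod_cast h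
    nlinarith
  have hb : z.im = 0 ∨ z.im = 1 := by omega
  rcases hb with hb | hb <;> rw [hb] at e1 <;> push_cast at e1
  · have ha1 : z.re < 2 := by exact_mod_cast (by linarith : (z.re : ℝ) < 2)
    have ha0 : 0 < z.re := by exact_mod_cast (by linarith : (0 : ℝ) < z.re)
    exact QuadraticAlgebra.ext (by simp; omega) (by simpa using hb)
  · have ha1 : z.re < 0 := by exact_mod_cast (by linarith : (z.re : ℝ) < 0)
    have ha0 : -1 < z.re := by exact_mod_cast (by linarith : (-1 : ℝ) < z.re)
    omega

theorem toReal_phi_zpow (k : ℤ) : toReal ((phi ^ k : GoldenIntˣ) : GoldenInt) =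
    Real.goldenRatio ^ k := by
  have h : toReal (phi : GoldenInt) = Real.goldenRatio := by simp [toReal_apply, phi]
  change ((Units.map (toReal : GoldenInt →* ℝ) (phi ^ k) : ℝˣ) : ℝ) = _
  rw [map_zpow, Units.val_zpow_eq_zpow_val, Units.coe_map, MonoidHom.coe_coe, h]

theorem units_eq_phi_zpow (e : GoldenIntˣ) : ∃ k : ℤ, e = phi ^ k ∨ e = -phi ^ k := by
  have hne : toReal (e : GoldenInt) ≠ 0 := (e.isUnit.map toReal).ne_zero
  wlog hpos : 0 < toReal (e : GoldenInt) generalizing e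
  · obtain ⟨k, hk⟩ := this (-e) (by simpa using hne)
      (by simpa using lt_of_le_of_ne (not_lt.1 hpos) hne)
    refine ⟨k, hk.symm.imp (fun h => ?_) (fun h => ?_)⟩
    · exact neg_injective h
    · rw [← h, neg_neg]
  obtain ⟨k, hk1, hk2⟩ := exists_mem_Ico_zpow hpos Real.one_lt_goldenRatio
  refine ⟨k, Or.inl ?_⟩
  have hp : (0 : ℝ) < Real.goldenRatio ^ k := zpow_pos Real.goldenRatio_pos k
  have hval : toReal ((e * phi ^ (-k) : GoldenIntˣ) : GoldenInt) =
      toReal (e : GoldenInt) / Real.goldenRatio ^ k := by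
    rw [Units.val_mul, map_mul, toReal_phi_zpow, zpow_neg, div_eq_mul_inv]
  have h1 : ((e * phi ^ (-k) : GoldenIntˣ) : GoldenInt) = 1 := by
    apply eq_one_of_isUnit_of_toReal_mem (Units.isUnit _)
    · rwa [hval, one_le_div hp]
    · rw [hval, div_lt_iff₀ hp, mul_comm, ← zpow_add_one₀ Real.goldenRatio_ne_zero]
      exact hk2
  have h2 : e * phi ^ (-k) = 1 := Units.ext h1
  rw [zpow_neg] at h2
  exact mul_inv_eq_one.1 h2

theorem units_eq_phi_pow_mul_cube (e : GoldenIntˣ) :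
    ∃ r < 3, ∃ f : GoldenIntˣ, e = phi ^ r * f ^ 3 := by
  obtain ⟨k, hk⟩ := units_eq_phi_zpow e
  have hr0 := Int.emod_nonneg k (by norm_num : (3 : ℤ) ≠ 0)
  have hr3 := Int.emod_lt_of_pos k (by norm_num : (0 : ℤ) < 3)
  have hpow : phi ^ k = phi ^ (k % 3).toNat * (phi ^ (k / 3)) ^ 3 := by
    rw [← zpow_natCast phi, Int.toNat_of_nonneg hr0, ← zpow_natCast (phi ^ (k / 3)), ← zpow_mul,
      ← zpow_add]
    congr 1
    push_cast
    omega
  refine ⟨(k % 3).toNat, by omega, ?_⟩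
  rcases hk with rfl | rfl
  · exact ⟨_, hpow⟩
  · exact ⟨-phi ^ (k / 3), by rw [hpow, Odd.neg_pow (by decide), mul_neg]⟩

theorem exists_eq_phi_pow_mul_cube {x y z : GoldenInt} (h : IsCoprime x y) (hxy : x * y = z ^ 3) :
    ∃ r < 3, ∃ α : GoldenInt, x = (phi : GoldenInt) ^ r * α ^ 3 := by
  obtain ⟨d, e, hd⟩ := exists_associated_pow_of_mul_eq_pow' h hxy
  obtain ⟨r, hr, f, hf⟩ := units_eq_phi_pow_mul_cube e
  refine ⟨r, hr, f * d, ?_⟩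
  rw [← hd, hf]
  push_cast
  ring

end GoldenInt

/-- The ring `ℤ[θ]` with `θ ^ 3 = 1 - 3 θ`; the triple `⟨a, b, c⟩` stands for `a + b θ + c θ ^ 2`. -/
@[ext]
structure CubicInt where
  /-- The constant coordinate. -/
  a : ℤ
  /-- The coefficient of `θ`. -/
  b : ℤ
  /-- The coefficient of `θ ^ 2`. -/
  c : ℤ

namespace CubicInt

instance : Zero CubicInt := ⟨⟨0, 0, 0⟩⟩
instance : One CubicInt := ⟨⟨1, 0, 0⟩⟩
instance : Add CubicInt := ⟨fun x y => ⟨x.a + y.a, x.b + y.b, x.c + y.c⟩⟩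
instance : Neg CubicInt := ⟨fun x => ⟨-x.a, -x.b, -x.c⟩⟩
instance : Mul CubicInt := ⟨fun x y =>
  ⟨x.a * y.a + x.b * y.c + x.c * y.b,
   x.a * y.b + x.b * y.a - 3 * (x.b * y.c + x.c * y.b) + x.c * y.c,
   x.a * y.c + x.b * y.b + x.c * y.a - 3 * (x.c * y.c)⟩⟩

@[simp] theorem zero_a : (0 : CubicInt).a = 0 := rfl
@[simp] theorem zero_b : (0 : CubicInt).b = 0 := rfl
@[simp] theorem zero_c : (0 : CubicInt).c = 0 := rfl
@[simp] theorem one_a : (1 : CubicInt).a = 1 := rfl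
@[simp] theorem one_b : (1 : CubicInt).b = 0 := rfl
@[simp] theorem one_c : (1 : CubicInt).c = 0 := rfl
@[simp] theorem add_a (x y : CubicInt) : (x + y).a = x.a + y.a := rfl
@[simp] theorem add_b (x y : CubicInt) : (x + y).b = x.b + y.b := rfl
@[simp] theorem add_c (x y : CubicInt) : (x + y).c = x.c + y.c := rfl
@[simp] theorem neg_a (x : CubicInt) : (-x).a = -x.a := rfl
@[simp] theorem neg_b (x : CubicInt) : (-x).b = -x.b := rfl
@[simp] theorem neg_c (x : CubicInt) : (-x).c = -x.c := rfl
@[simp] theorem mul_a (x y : CubicInt) :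
    (x * y).a = x.a * y.a + x.b * y.c + x.c * y.b := rfl
@[simp] theorem mul_b (x y : CubicInt) :
    (x * y).b = x.a * y.b + x.b * y.a - 3 * (x.b * y.c + x.c * y.b) + x.c * y.c := rfl
@[simp] theorem mul_c (x y : CubicInt) :
    (x * y).c = x.a * y.c + x.b * y.b + x.c * y.a - 3 * (x.c * y.c) := rfl

instance : CommRing CubicInt where
  add_assoc x y z := by ext <;> simp [add_assoc]
  zero_add x := by ext <;> simp
  add_zero x := by ext <;> simp
  add_comm x y := by ext <;> simp [add_comm]
  neg_add_cancel x := by ext <;> simp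
  mul_assoc x y z := by ext <;> simp <;> ring
  one_mul x := by ext <;> simp
  mul_one x := by ext <;> simp
  mul_comm x y := by ext <;> simp <;> ring
  left_distrib x y z := by ext <;> simp <;> ring
  right_distrib x y z := by ext <;> simp <;> ring
  zero_mul x := by ext <;> simp
  mul_zero x := by ext <;> simp
  nsmul := nsmulRec
  zsmul := zsmulRec

/-- The inclusion of `ℤ` into `ℤ[θ]`. -/
def ofInt : ℤ →+* CubicInt where
  toFun n := ⟨n, 0, 0⟩
  map_zero' := rfl
  map_one' := rfl
  map_add' m n := by ext <;> simp
  map_mul' m n := by ext <;> simp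

theorem intCast_eq (n : ℤ) : (n : CubicInt) = ⟨n, 0, 0⟩ :=
  (eq_intCast ofInt n).symm

/-- The norm from `ℤ[θ]` to `ℤ`. -/
def norm : CubicInt →* ℤ where
  toFun x := x.a ^ 3 + x.b ^ 3 + x.c ^ 3 - 6 * x.a ^ 2 * x.c + 3 * x.a * x.b ^ 2
    + 9 * x.a * x.c ^ 2 + 3 * x.b * x.c ^ 2 - 3 * x.a * x.b * x.c
  map_one' := by simp
  map_mul' x y := by simp; ring

theorem norm_apply (x : CubicInt) :
    norm x = x.a ^ 3 + x.b ^ 3 + x.c ^ 3 - 6 * x.a ^ 2 * x.c + 3 * x.a * x.b ^ 2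
      + 9 * x.a * x.c ^ 2 + 3 * x.b * x.c ^ 2 - 3 * x.a * x.b * x.c := rfl

/-- The fundamental unit `θ` of `ℤ[θ]`. -/
def theta : CubicIntˣ where
  val := ⟨0, 1, 0⟩
  inv := ⟨3, 0, 1⟩
  val_inv := by ext <;> simp
  inv_val := by ext <;> simp

theorem exists_real_root : ∃ t : ℝ, t ^ 3 = 1 - 3 * t ∧ 0.32 < t ∧ t < 0.323 := by
  have hc : ContinuousOn (fun t : ℝ => t ^ 3 + 3 * t) (Set.Icc 0.32 0.323) := by fun_prop
  obtain ⟨t, ht, h⟩ := intermediate_value_Ioo (by norm_num) hc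
    (show (1 : ℝ) ∈ Set.Ioo _ _ by constructor <;> norm_num)
  exact ⟨t, by simp only at h; linarith, ht.1, ht.2⟩

/-- The real root of `X ^ 3 + 3 X - 1`. -/
noncomputable def root : ℝ := exists_real_root.choose

theorem root_cubed : root ^ 3 = 1 - 3 * root := exists_real_root.choose_spec.1

theorem lt_root : 0.32 < root := exists_real_root.choose_spec.2.1

theorem root_lt : root < 0.323 := exists_real_root.choose_spec.2.2

/-- The real embedding of `ℤ[θ]`. -/
noncomputable def toReal : CubicInt →+* ℝ where
  toFun x := x.a + x.b * root + x.c * root ^ 2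
  map_zero' := by simp
  map_one' := by simp
  map_add' x y := by simp; ring
  map_mul' x y := by
    simp
    linear_combination (-(x.b : ℝ) * y.c - x.c * y.b - x.c * y.c * root) * root_cubed

theorem toReal_apply (x : CubicInt) : toReal x = x.a + x.b * root + x.c * root ^ 2 := rfl

/-- The norm is the product of the real embedding and the squared absolute value of the complex
embedding, the latter written as a sum of squares. -/
theorem norm_eq_toReal_mul (x : CubicInt) :
    (norm x : ℝ) = toReal x *
      ((x.a - x.b * root / 2 - x.c * (root ^ 2 + 6) / 2) ^ 2
        + (3 + 3 / 4 * root ^ 2) * (x.b - x.c * root) ^ 2) := by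
  have h4 : root ^ 4 = root - 3 * root ^ 2 := by linear_combination root * root_cubed
  have h6 : root ^ 6 = root ^ 3 - 3 * root ^ 4 := by linear_combination root ^ 3 * root_cubed
  rw [norm_apply, toReal_apply]
  push_cast
  ring_nf
  rw [h6, h4, root_cubed]
  ring

theorem eq_one_of_norm_eq_one_of_toReal_mem {x : CubicInt} (hN : norm x = 1)
    (h1 : 1 ≤ toReal x) (h2 : toReal x < root⁻¹) : x = 1 := by
  have hl := lt_root
  have hu := root_lt
  have hinv : root⁻¹ = 3 + root ^ 2 := by
    have : root ≠ 0 := by linarith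
    field_simp
    linear_combination -root_cubed
  rw [hinv] at h2
  have hQ := norm_eq_toReal_mul x
  rw [hN] at hQ
  push_cast at hQ
  have hs1 := sq_nonneg ((x.a : ℝ) - x.b * root / 2 - x.c * (root ^ 2 + 6) / 2)
  have hs2 := sq_nonneg ((x.b : ℝ) - x.c * root)
  set A := (x.a : ℝ) - x.b * root / 2 - x.c * (root ^ 2 + 6) / 2 with hA
  set B := (x.b : ℝ) - x.c * root with hB
  have hB3 : 3 * B ^ 2 ≤ (3 + 3 / 4 * root ^ 2) * B ^ 2 := by nlinarith [sq_nonneg root]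
  have hle : A ^ 2 + (3 + 3 / 4 * root ^ 2) * B ^ 2 ≤ 1 := by nlinarith
  have hAb := abs_le.1 (abs_le_one_iff_mul_self_le_one.2 (by nlinarith : A * A ≤ 1))
  have hBb : |B| ≤ 0.58 := abs_le_of_sq_le_sq (by nlinarith) (by norm_num)
  rw [abs_le] at hBb
  rw [toReal_apply] at h1 h2
  have hr2 : 0.1 < root ^ 2 ∧ root ^ 2 < 0.105 := by constructor <;> nlinarith
  have hkey : (x.a + x.b * root + x.c * root ^ 2 : ℝ) - A
      = 3 / 2 * root * B + x.c * (3 + 3 * root ^ 2) := by rw [hA, hB]; ring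
  have hBr1 : root * B ≤ 0.2 := by nlinarith
  have hBr2 : -0.2 ≤ root * B := by nlinarith
  have hc1 : x.c < 2 := by
    by_contra! h
    have h2c : (2 : ℝ) ≤ x.c := by exact_mod_cast h
    have := mul_nonneg (sub_nonneg.2 h2c) (sq_nonneg root)
    linarith
  have hc0 : -1 < x.c := by
    by_contra! h
    have hc1 : (x.c : ℝ) ≤ -1 := by exact_mod_cast h
    have := mul_nonneg (sub_nonneg.2 hc1) (sq_nonneg root)
    linarith
  have hc : x.c = 0 ∨ x.c = 1 := by omega
  rcases hc with hc | hc <;> rw [hc] at hB hA h1 h2 <;> push_cast at hB hA h1 h2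
  all_goals
    have hb1 : x.b < 1 := by exact_mod_cast (by linarith : (x.b : ℝ) < 1)
    have hb0 : -1 < x.b := by exact_mod_cast (by linarith : (-1 : ℝ) < x.b)
    have hb : x.b = 0 := by omega
    rw [hb] at hA h1 h2
    push_cast at hA h1 h2
  · have ha1 : x.a < 2 := by exact_mod_cast (by linarith : (x.a : ℝ) < 2)
    have ha0 : 0 < x.a := by exact_mod_cast (by linarith : (0 : ℝ) < x.a)
    ext <;> simp [hb, hc]
    omega
  · have ha1 : x.a < 3 := by exact_mod_cast (by linarith : (x.a : ℝ) < 3)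
    have ha0 : 2 < x.a := by exact_mod_cast (by linarith : (2 : ℝ) < x.a)
    omega

theorem toReal_theta_zpow (k : ℤ) : toReal ((theta ^ k : CubicIntˣ) : CubicInt) = root ^ k := by
  have h : toReal (theta : CubicInt) = root := by simp [toReal_apply, theta]
  change ((Units.map (toReal : CubicInt →* ℝ) (theta ^ k) : ℝˣ) : ℝ) = _
  rw [map_zpow, Units.val_zpow_eq_zpow_val, Units.coe_map, MonoidHom.coe_coe, h]

theorem norm_theta_zpow (k : ℤ) : norm ((theta ^ k : CubicIntˣ) : CubicInt) = 1 := by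
  have h : Units.map norm theta = 1 := Units.ext (by simp [norm_apply, theta])
  have := (Units.map norm).map_zpow theta k
  rw [h, one_zpow] at this
  exact congrArg Units.val this

theorem eq_theta_zpow_of_norm_eq_one {x : CubicInt} (hN : norm x = 1) :
    ∃ k : ℤ, x = (theta ^ k : CubicIntˣ) := by
  have hr : (0 : ℝ) < root := by linarith [lt_root]
  have hpos : 0 < toReal x := by
    have h := norm_eq_toReal_mul x
    rw [hN] at h
    push_cast at h
    by_contra! hneg
    nlinarith [mul_nonneg (neg_nonneg.2 hneg) (by positivity :
      0 ≤ ((x.a - x.b * root / 2 - x.c * (root ^ 2 + 6) / 2) ^ 2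
        + (3 + 3 / 4 * root ^ 2) * (x.b - x.c * root) ^ 2 : ℝ))]
  obtain ⟨k, hk1, hk2⟩ := exists_mem_Ico_zpow hpos
    (show 1 < root⁻¹ from (one_lt_inv₀ hr).2 (by linarith [root_lt]))
  rw [inv_zpow'] at hk1 hk2
  refine ⟨-k, ?_⟩
  have hval : toReal (x * (theta ^ k : CubicIntˣ)) = toReal x * root ^ k := by
    rw [map_mul, toReal_theta_zpow]
  have hp : (0 : ℝ) < root ^ k := zpow_pos hr k
  have h1 : x * (theta ^ k : CubicIntˣ) = 1 := by
    apply eq_one_of_norm_eq_one_of_toReal_mem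
    · rw [map_mul, hN, norm_theta_zpow, one_mul]
    · rw [hval]
      have := mul_le_mul_of_nonneg_right hk1 hp.le
      rwa [← zpow_add₀ hr.ne', neg_add_cancel, zpow_zero] at this
    · rw [hval]
      have := mul_lt_mul_of_pos_right hk2 hp
      rw [← zpow_add₀ hr.ne'] at this
      simpa using this
  rw [zpow_neg]
  exact (Units.mul_eq_one_iff_eq_inv).1 h1

/-- The linear form `2 b - c`, which vanishes on `ℤ + ℤ (4 + θ + 2 θ ^ 2)`. -/
def defect : CubicInt →+ ℤ where
  toFun x := 2 * x.b - x.c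
  map_zero' := by simp
  map_add' x y := by simp; ring

theorem defect_apply (x : CubicInt) : defect x = 2 * x.b - x.c := rfl

theorem defect_intCast_mul (n : ℤ) (x : CubicInt) : defect (n * x) = n * defect x := by
  rw [← zsmul_eq_mul, map_zsmul, smul_eq_mul]

/-- `x` is `3`-adically close to `1`, and `defect` detects the leading term of `x - 1`. -/
def NearOne (x : CubicInt) : Prop :=
  ∃ (s : ℕ) (y : CubicInt), x = 1 + ((3 ^ (s + 1) : ℤ) : CubicInt) * y ∧ ¬ (3 : ℤ) ∣ defect y

theorem NearOne.defect_ne_zero {x : CubicInt} (h : NearOne x) : defect x ≠ 0 := by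
  obtain ⟨s, y, rfl, hy⟩ := h
  rw [map_add, defect_intCast_mul, show defect 1 = 0 by simp [defect_apply], zero_add]
  refine mul_ne_zero (by positivity) ?_
  rintro h
  exact hy (h ▸ dvd_zero _)

theorem NearOne.cube {x : CubicInt} (h : NearOne x) : NearOne (x ^ 3) := by
  obtain ⟨s, y, rfl, hy⟩ := h
  refine ⟨s + 1, y + ((3 : ℤ) : CubicInt) *
    (((3 ^ s : ℤ) : CubicInt) * y ^ 2 + ((3 ^ (2 * s) : ℤ) : CubicInt) * y ^ 3), ?_, ?_⟩
  · push_cast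
    ring
  · rwa [map_add, defect_intCast_mul, dvd_add_left (dvd_mul_right _ _)]

theorem NearOne.pow_of_not_dvd {x : CubicInt} (h : NearOne x) {q : ℕ} (hq : ¬ 3 ∣ q) :
    NearOne (x ^ q) := by
  obtain ⟨s, y, rfl, hy⟩ := h
  have key : ∀ q : ℕ, ∃ z : CubicInt, (1 + ((3 ^ (s + 1) : ℤ) : CubicInt) * y) ^ q =
      1 + ((3 ^ (s + 1) : ℤ) : CubicInt) * (((q : ℤ) : CubicInt) * y + ((3 : ℤ) : CubicInt) * z) := by
    intro q
    induction q with
    | zero => exact ⟨0, by simp⟩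
    | succ q ih =>
      obtain ⟨z, hz⟩ := ih
      refine ⟨z + ((3 ^ s : ℤ) : CubicInt) * y * (q * y + 3 * z), ?_⟩
      rw [pow_succ, hz]
      push_cast
      ring
  obtain ⟨z, hz⟩ := key q
  refine ⟨s, _, hz, ?_⟩
  rw [map_add, defect_intCast_mul, defect_intCast_mul, dvd_add_left (dvd_mul_right _ _)]
  intro hd
  rcases Int.prime_three.dvd_or_dvd hd with h | h
  · exact hq (by exact_mod_cast h)
  · exact hy h

theorem NearOne.pow {x : CubicInt} (h : NearOne x) {n : ℕ} (hn : n ≠ 0) : NearOne (x ^ n) := by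
  obtain ⟨e, q, hq, rfl⟩ := Nat.exists_eq_pow_mul_and_not_dvd hn 3 (by norm_num)
  rw [mul_comm, pow_mul]
  have h2 := h.pow_of_not_dvd hq
  clear hn
  induction e with
  | zero => simpa using h2
  | succ e ih => rw [pow_succ 3, pow_mul]; exact ih.cube

theorem nearOne_theta_pow_three : NearOne ((theta ^ 3 : CubicIntˣ) : CubicInt) := by
  refine ⟨0, ⟨0, -1, 0⟩, ?_, by simp [defect_apply]⟩
  rw [intCast_eq]
  ext <;> simp [theta, pow_succ]

theorem nearOne_theta_inv_pow_three : NearOne ((theta⁻¹ ^ 3 : CubicIntˣ) : CubicInt) := by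
  refine ⟨0, ⟨9, 1, 3⟩, ?_, by simp [defect_apply]⟩
  rw [intCast_eq, Units.val_pow_eq_pow_val, show ((theta⁻¹ : CubicIntˣ) : CubicInt) = ⟨3, 0, 1⟩ from rfl]
  ext <;> simp [pow_succ]

theorem nearOne_theta_zpow {j : ℤ} (hj : j ≠ 0) :
    NearOne ((theta ^ (3 * j) : CubicIntˣ) : CubicInt) := by
  obtain ⟨n, rfl | rfl⟩ := j.eq_nat_or_neg
  · have h := nearOne_theta_pow_three.pow (n := n) (by simpa using hj)
    rwa [← Units.val_pow_eq_pow_val, ← pow_mul, ← zpow_natCast, Nat.cast_mul] at h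
  · have h := nearOne_theta_inv_pow_three.pow (n := n) (by simpa using hj)
    rw [← Units.val_pow_eq_pow_val, ← pow_mul, ← zpow_natCast, Nat.cast_mul, inv_zpow',
      ← mul_neg] at h
    exact h

theorem exists_theta_zpow_three_mul_eq (j : ℤ) :
    ∃ z : CubicInt, ((theta ^ (3 * j) : CubicIntˣ) : CubicInt) = 1 + ((3 : ℤ) : CubicInt) * z := by
  by_cases hj : j = 0
  · exact ⟨0, by simp [hj]⟩
  · obtain ⟨s, y, h, -⟩ := nearOne_theta_zpow hj
    refine ⟨((3 ^ s : ℤ) : CubicInt) * y, ?_⟩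
    rw [h]
    push_cast
    ring

theorem eq_zero_of_defect_theta_zpow_eq_zero {k : ℤ}
    (h : defect (theta ^ k : CubicIntˣ) = 0) : k = 0 := by
  have hdvd (r : ℕ) (hr : k = r + 3 * (k / 3)) : (3 : ℤ) ∣ defect ((theta : CubicInt) ^ r) := by
    obtain ⟨z, hz⟩ := exists_theta_zpow_three_mul_eq (k / 3)
    rw [hr, zpow_add, Units.val_mul, hz, zpow_natCast, Units.val_pow_eq_pow_val, mul_add, mul_one,
      mul_left_comm, map_add, defect_intCast_mul] at h
    exact ⟨_, by rw [eq_neg_of_add_eq_zero_left h, mul_neg]⟩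
  obtain hr | hr | hr : k = (0 : ℕ) + 3 * (k / 3) ∨ k = (1 : ℕ) + 3 * (k / 3) ∨
      k = (2 : ℕ) + 3 * (k / 3) := by
    push_cast
    omega
  · by_contra hk
    rw [Nat.cast_zero, zero_add] at hr
    refine (nearOne_theta_zpow (j := k / 3) (by omega)).defect_ne_zero ?_
    rwa [← hr]
  · have := hdvd 1 hr
    simp [defect_apply, theta] at this
  · have := hdvd 2 hr
    simp [defect_apply, theta, pow_succ] at this

theorem cubic_form_eq_one {m n : ℤ} (h : m ^ 3 - 15 * m * n ^ 2 + 25 * n ^ 3 = 1) :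
    m = 1 ∧ n = 0 := by
  have hN : norm ⟨m + 4 * n, n, 2 * n⟩ = 1 := by
    rw [norm_apply, ← h]; ring
  obtain ⟨k, hk⟩ := eq_theta_zpow_of_norm_eq_one hN
  have hk0 : k = 0 := eq_zero_of_defect_theta_zpow_eq_zero (by rw [← hk, defect_apply]; ring)
  rw [hk0] at hk
  have ha := congrArg CubicInt.a hk
  have hb := congrArg CubicInt.b hk
  simp at ha hb
  omega

end CubicInt

theorem eq_one_and_eq_zero_of_trace_phi_mul_cube {m n : ℤ}
    (h : m ^ 3 + 9 * m ^ 2 * n + 12 * m * n ^ 2 + 7 * n ^ 3 = 1) : m = 1 ∧ n = 0 := by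
  obtain ⟨h1, h2⟩ := CubicInt.cubic_form_eq_one (m := m + 3 * n) (n := n) (by
    rw [← h]; ring)
  omega

theorem trace_cube_ne_one (m n : ℤ) : 2 * m ^ 3 + 3 * m ^ 2 * n + 9 * m * n ^ 2 + 4 * n ^ 3 ≠ 1 := by
  intro h
  have h4 : (2 * m + n) * ((2 * m + n) ^ 2 + 15 * n ^ 2) = 4 := by linear_combination 4 * h
  have hle : 2 * m + n < 2 := by
    by_contra! hc
    nlinarith [sq_nonneg n]
  have hpos : 0 < 2 * m + n := by
    by_contra! hc
    nlinarith [sq_nonneg n, sq_nonneg (2 * m + n)]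
  obtain h1 : 2 * m + n = 1 := by omega
  rw [h1] at h4
  omega

theorem sq_eq_one_of_five_mul_sq_sub_one_eq {u w : ℤ} (h : 5 * u ^ 2 - 1 = 4 * w ^ 3) :
    u ^ 2 = 1 := by
  obtain ⟨t, rfl⟩ : Odd u := by
    rw [← Int.not_even_iff_odd]
    rintro ⟨t, rfl⟩
    ring_nf at h
    omega
  have hprod : (⟨-t, 2 * t + 1⟩ : GoldenInt) * star ⟨-t, 2 * t + 1⟩ = (-(w : GoldenInt)) ^ 3 := by
    have hn : QuadraticAlgebra.norm (⟨-t, 2 * t + 1⟩ : GoldenInt) = (-w) ^ 3 := by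
      rw [GoldenInt.norm_eq]
      linarith
    rw [← QuadraticAlgebra.algebraMap_norm_eq_mul_star, hn]
    simp
  have hcop : IsCoprime (⟨-t, 2 * t + 1⟩ : GoldenInt) (star ⟨-t, 2 * t + 1⟩) :=
    ⟨1, 1, by ext <;> simp; ring⟩
  obtain ⟨r, hr, ⟨m, n⟩, hα⟩ := GoldenInt.exists_eq_phi_pow_mul_cube hcop hprod
  have hre := congrArg QuadraticAlgebra.re hα
  have him := congrArg QuadraticAlgebra.im hα
  interval_cases r <;> simp [GoldenInt.phi, pow_succ] at hre him
  · exact absurd (by linarith) (trace_cube_ne_one m n)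
  · obtain ⟨rfl, rfl⟩ := eq_one_and_eq_zero_of_trace_phi_mul_cube (m := m) (n := n) (by linarith)
    simp at him
    simp [him]
  · obtain ⟨h1, h2⟩ := eq_one_and_eq_zero_of_trace_phi_mul_cube (m := -m - 2 * n) (n := m + n) (by linarith)
    obtain rfl : n = -1 := by omega
    obtain rfl : m = 1 := by omega
    simp at him
    obtain rfl : t = -1 := by omega
    norm_num

/-- If `x^2 - 125 = 4·y^l` with `5 ∣ x`, `y > 0`, `l > 1` and `l` odd, then
`(x, y, l) = (±25, 5, 3)`. -/
theorem x_sq_sub_125_eq_four_pow_odd (x y : ℤ) (l : ℕ)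
    (hx : (5 : ℤ) ∣ x) (hy : 0 < y) (hl : 1 < l) (hlodd : Odd l)
    (heq : x ^ 2 - 125 = 4 * y ^ l) :
    (x = 25 ∨ x = -25) ∧ y = 5 ∧ l = 3 := by
  have h5 : Prime (5 : ℤ) := by norm_num
  obtain ⟨z, rfl⟩ := hx
  obtain ⟨k, rfl⟩ : ∃ k, l = k + 3 := by
    obtain ⟨j, rfl⟩ := hlodd
    exact ⟨2 * j - 2, by omega⟩
  obtain ⟨w, rfl⟩ : (5 : ℤ) ∣ y := by
    have h : (5 : ℤ) ∣ 4 * y ^ (k + 3) := ⟨5 * z ^ 2 - 25, by rw [← heq]; ring⟩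
    exact h5.dvd_of_dvd_pow ((h5.dvd_or_dvd h).resolve_left (by norm_num))
  obtain ⟨u, rfl⟩ : (5 : ℤ) ∣ z := by
    refine h5.dvd_of_dvd_pow (n := 2) ⟨1 + 4 * 5 ^ k * w ^ (k + 3), ?_⟩
    have : 25 * z ^ 2 = 25 * (5 * (1 + 4 * 5 ^ k * w ^ (k + 3))) := by
      linear_combination heq
    linarith
  have hred : 5 * u ^ 2 - 1 = 4 * (5 ^ k * w ^ (k + 3)) := by
    have : 125 * (5 * u ^ 2 - 1) = 125 * (4 * (5 ^ k * w ^ (k + 3))) := by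
      linear_combination heq
    linarith
  obtain rfl : k = 0 := by
    by_contra hk
    have h : (5 : ℤ) ∣ 4 * (5 ^ k * w ^ (k + 3)) := ((dvd_pow_self 5 hk).mul_right _).mul_left _
    omega
  rw [pow_zero, one_mul, zero_add] at hred
  have hu := sq_eq_one_of_five_mul_sq_sub_one_eq hred
  have hw : w = 1 := by
    have hw3 : w ^ 3 = 1 ^ 3 := by linarith
    exact (Odd.strictMono_pow (by decide : Odd 3)).injective hw3
  refine ⟨?_, by omega, rfl⟩
  rcases sq_eq_sq_iff_eq_or_eq_neg.1 (hu.trans (one_pow 2).symm) with rfl | rfl <;> norm_num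
end
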